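/- For each prime g ≥ 5 and every ε > 0 there exists a constant C = C(g, ε) such that for all real X ≥ 2, the sum of h_g(-d) over squarefree integers d with 0 < d < X is at most C · X^{3/2 - 3/(2g+2) + ε}. -/

import Mathlib

/-- The imaginary quadratic field `ℚ(√-d)`, realized as the subfield of `ℂ`
generated over `ℚ` by `√d · i`. -/
noncomputable def Kneg (d : ℕ) : IntermediateField ℚ ℂ :=
  IntermediateField.adjoin ℚ {(Real.sqrt d : ℂ) * Complex.I}

/-- `hneg g d` is the `g`-part of the class number of `ℚ(√-d)`: the number of
ideal classes `c` of the ring of integers of `ℚ(√-d)` with `c ^ g = 1`. -/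
noncomputable def hneg (g d : ℕ) : ℕ :=
  Nat.card {c : ClassGroup (NumberField.RingOfIntegers (Kneg d)) // c ^ g = 1}

/-- `s` is a square root of `-d` in `R`, and every element of `R` has the form `(u + v s) / 2`
with integers `u, v`, with norm `(u ^ 2 + d v ^ 2) / 4`. -/
structure IsImaginaryQuadratic (R : Type*) [CommRing R] (d : ℕ) (s : R) : Prop where
  sq_eq : s ^ 2 = -(d : R)
  exists_rep : ∀ x : R, ∃ u v : ℤ, 2 * x = u + v * s
  norm_eq : ∀ (x : R) (u v : ℤ), 2 * x = u + v * s → 4 * Algebra.norm ℤ x = u ^ 2 + d * v ^ 2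

section KnegStructure

variable {d : ℕ}

lemma sqrt_mul_I_sq (d : ℕ) : ((Real.sqrt d : ℂ) * Complex.I) ^ 2 = -(d : ℂ) := by
  rw [mul_pow, Complex.I_sq, ← Complex.ofReal_pow, Real.sq_sqrt (Nat.cast_nonneg d)]
  simp

/-- The algebra `ℚ[ω]` with `ω ^ 2 = -d`, embedded in `ℂ`. -/
noncomputable def quadraticToComplex (d : ℕ) : QuadraticAlgebra ℚ (-(d : ℚ)) 0 →ₐ[ℚ] ℂ :=
  QuadraticAlgebra.lift ⟨(Real.sqrt d : ℂ) * Complex.I, by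
    rw [← sq, sqrt_mul_I_sq]; simp [Algebra.smul_def]⟩

lemma quadraticToComplex_apply (d : ℕ) (z : QuadraticAlgebra ℚ (-(d : ℚ)) 0) :
    quadraticToComplex d z = z.re + z.im * ((Real.sqrt d : ℂ) * Complex.I) := by
  simp [quadraticToComplex, QuadraticAlgebra.lift, Algebra.smul_def]

lemma neg_not_square (hd : 0 < d) (r : ℚ) : r ^ 2 ≠ -(d : ℚ) + 0 * r := by
  have : (0 : ℚ) < d := by exact_mod_cast hd
  nlinarith [sq_nonneg r]

lemma fieldRange_quadraticToComplex (hd : 0 < d) :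
    haveI : Fact (∀ r : ℚ, r ^ 2 ≠ -(d : ℚ) + 0 * r) := ⟨neg_not_square hd⟩
    (quadraticToComplex d).fieldRange = Kneg d := by
  have : Fact (∀ r : ℚ, r ^ 2 ≠ -(d : ℚ) + 0 * r) := ⟨neg_not_square hd⟩
  apply le_antisymm
  · rintro _ ⟨z, rfl⟩
    have hs : (Real.sqrt d : ℂ) * Complex.I ∈ Kneg d :=
      IntermediateField.subset_adjoin ℚ _ rfl
    have : quadraticToComplex d z ∈ Kneg d := by
      rw [quadraticToComplex_apply]
      exact add_mem (SubfieldClass.ratCast_mem _ _) (mul_mem (SubfieldClass.ratCast_mem _ _) hs)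
    exact this
  · rw [Kneg, IntermediateField.adjoin_le_iff]
    rintro _ rfl
    refine ⟨⟨0, 1⟩, ?_⟩
    have := quadraticToComplex_apply d ⟨0, 1⟩
    simpa using this

/-- `ℚ(√-d)` as a quadratic algebra. -/
noncomputable def quadraticEquivKneg (hd : 0 < d) :
    QuadraticAlgebra ℚ (-(d : ℚ)) 0 ≃ₐ[ℚ] Kneg d :=
  haveI : Fact (∀ r : ℚ, r ^ 2 ≠ -(d : ℚ) + 0 * r) := ⟨neg_not_square hd⟩
  (AlgEquiv.ofInjectiveField (quadraticToComplex d)).trans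
    (IntermediateField.equivOfEq (fieldRange_quadraticToComplex hd))

lemma numberField_kneg (hd : 0 < d) : NumberField (Kneg d) where
  to_charZero := inferInstance
  to_finiteDimensional := Module.Finite.equiv (quadraticEquivKneg hd).toLinearEquiv

lemma algebra_norm_quadraticAlgebra (a b : ℚ) (z : QuadraticAlgebra ℚ a b) :
    Algebra.norm ℚ z = z.norm := by
  rw [← QuadraticAlgebra.det_toLinearMap_eq_norm]
  rfl

lemma algebra_norm_quadraticEquivKneg (hd : 0 < d) (z : QuadraticAlgebra ℚ (-(d : ℚ)) 0) :
    Algebra.norm ℚ (quadraticEquivKneg hd z) = z.re ^ 2 + d * z.im ^ 2 := by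
  rw [Algebra.norm_eq_of_algEquiv, algebra_norm_quadraticAlgebra, QuadraticAlgebra.norm_def]
  ring

lemma isIntegral_two_re_and_norm (hd : 0 < d) (z : QuadraticAlgebra ℚ (-(d : ℚ)) 0)
    (hz : IsIntegral ℤ z) :
    (∃ u : ℤ, (u : ℚ) = 2 * z.re) ∧ ∃ n : ℤ, (n : ℚ) = z.re ^ 2 + d * z.im ^ 2 := by
  have : Fact (∀ r : ℚ, r ^ 2 ≠ -(d : ℚ) + 0 * r) := ⟨neg_not_square hd⟩
  have hs : IsIntegral ℤ (star z) := by
    let e : QuadraticAlgebra ℚ (-(d : ℚ)) 0 →+* QuadraticAlgebra ℚ (-(d : ℚ)) 0 :=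
      starRingEnd _
    exact hz.map (e.toIntAlgHom)
  constructor
  · have h := hz.add hs
    have h2 : z + star z = algebraMap ℚ _ (2 * z.re) := by
      rw [← QuadraticAlgebra.algebraMap_trace_eq_add_star, QuadraticAlgebra.trace_def]
      simp
    rw [h2, isIntegral_algebraMap_iff (algebraMap ℚ _).injective] at h
    obtain ⟨u, hu⟩ := IsIntegrallyClosed.isIntegral_iff.mp h
    exact ⟨u, hu⟩
  · have h := hz.mul hs
    rw [← QuadraticAlgebra.algebraMap_norm_eq_mul_star,
      isIntegral_algebraMap_iff (algebraMap ℚ _).injective] at h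
    obtain ⟨u, hu⟩ := IsIntegrallyClosed.isIntegral_iff.mp h
    refine ⟨u, ?_⟩
    have : (u : ℚ) = z.norm := hu
    rw [this, QuadraticAlgebra.norm_def]
    ring

lemma exists_int_of_squarefree_mul_sq (hd : Squarefree d) (q : ℚ) (n : ℤ)
    (h : (n : ℚ) = d * q ^ 2) : ∃ v : ℤ, (v : ℚ) = q := by
  have hden : (q.den : ℚ) ≠ 0 := by exact_mod_cast q.den_ne_zero
  have h1 : n * (q.den : ℤ) ^ 2 = d * q.num ^ 2 := by
    have : (n : ℚ) * (q.den : ℚ) ^ 2 = d * (q.num : ℚ) ^ 2 := by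
      rw [h]
      conv_lhs => rw [← Rat.num_div_den q]
      field_simp
      simp [Rat.num_div_den]
    exact_mod_cast this
  have h2 : (q.den : ℤ) ^ 2 ∣ d := by
    have : IsCoprime ((q.den : ℤ) ^ 2) (q.num ^ 2) :=
      (Rat.isCoprime_num_den q).symm.pow
    exact this.dvd_of_dvd_mul_right ⟨n, by linarith⟩
  have h3 : q.den * q.den ∣ d := by
    rw [← sq]; exact_mod_cast h2
  have h4 : q.den = 1 := Nat.isUnit_iff.mp (hd _ h3)
  exact ⟨q.num, Rat.coe_int_num_of_den_eq_one h4⟩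

/-- The ring of integers of `ℚ(√-d)` is contained in `(ℤ + ℤ √-d) / 2`. -/
theorem exists_isImaginaryQuadratic_kneg (hd : 0 < d) (hsq : Squarefree d) :
    ∃ s, IsImaginaryQuadratic (NumberField.RingOfIntegers (Kneg d)) d s := by
  have := numberField_kneg hd
  let e := quadraticEquivKneg hd
  have hω : IsIntegral ℤ (e ⟨0, 1⟩) := by
    refine ⟨Polynomial.X ^ 2 + Polynomial.C (d : ℤ), by monicity!, ?_⟩
    rw [Polynomial.eval₂_add, Polynomial.eval₂_pow, Polynomial.eval₂_X, Polynomial.eval₂_C,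
      ← map_pow]
    have : (⟨0, 1⟩ : QuadraticAlgebra ℚ (-(d : ℚ)) 0) ^ 2 =
        -(d : QuadraticAlgebra ℚ (-(d : ℚ)) 0) := by
      ext <;> simp [sq]
    rw [this]
    simp
  let s : NumberField.RingOfIntegers (Kneg d) := ⟨e ⟨0, 1⟩, hω⟩
  have hrep : ∀ (x : NumberField.RingOfIntegers (Kneg d)) (u v : ℤ),
      2 * x = u + v * s ↔ 2 * (e.symm x).re = u ∧ 2 * (e.symm x).im = v := by
    intro x u v
    rw [NumberField.RingOfIntegers.ext_iff, ← e.symm.injective.eq_iff]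
    have hs : e.symm (s : Kneg d) = ⟨0, 1⟩ := e.symm_apply_apply _
    simp only [map_add, map_mul, map_ofNat, map_intCast, hs]
    have hre : (2 : QuadraticAlgebra ℚ (-(d : ℚ)) 0).re = 2 := QuadraticAlgebra.re_natCast 2
    have him : (2 : QuadraticAlgebra ℚ (-(d : ℚ)) 0).im = 0 := QuadraticAlgebra.im_natCast 2
    rw [QuadraticAlgebra.ext_iff]
    simp [hre, him]
  refine ⟨s, ?_, ?_, ?_⟩
  · rw [NumberField.RingOfIntegers.ext_iff, ← e.symm.injective.eq_iff]
    have hs : e.symm (s : Kneg d) = ⟨0, 1⟩ := e.symm_apply_apply _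
    simp only [map_pow, map_neg, map_natCast, hs]
    ext <;> simp [sq]
  · intro x
    have hx : IsIntegral ℤ (e.symm x) :=
      x.isIntegral_coe.map (e.symm.toAlgHom.restrictScalars ℤ)
    obtain ⟨⟨u, hu⟩, n, hn⟩ := isIntegral_two_re_and_norm hd _ hx
    obtain ⟨v, hv⟩ := exists_int_of_squarefree_mul_sq hsq (2 * (e.symm x).im) (4 * n - u ^ 2)
      (by push_cast; rw [hn, hu]; ring)
    exact ⟨u, v, (hrep x u v).mpr ⟨hu.symm, hv.symm⟩⟩
  · intro x u v h
    obtain ⟨h1, h2⟩ := (hrep x u v).mp h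
    have h3 : ((Algebra.norm ℤ x : ℤ) : ℚ) = Algebra.norm ℚ (x : Kneg d) := Algebra.coe_norm_int x
    have h4 := algebra_norm_quadraticEquivKneg hd (e.symm x)
    rw [show quadraticEquivKneg hd (e.symm x) = (x : Kneg d) from e.apply_symm_apply _, ← h3] at h4
    have : (4 * (Algebra.norm ℤ x : ℤ) : ℚ) = (u : ℚ) ^ 2 + d * (v : ℚ) ^ 2 := by
      rw [h4, ← h1, ← h2]; ring
    exact_mod_cast this

end KnegStructure

namespace IsImaginaryQuadratic

variable {R : Type*} [CommRing R] {d : ℕ} {s : R}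

lemma norm_add_mul (h : IsImaginaryQuadratic R d s) (m n : ℤ) :
    Algebra.norm ℤ ((m : R) + n * s) = m ^ 2 + d * n ^ 2 := by
  have := h.norm_eq (m + n * s) (2 * m) (2 * n) (by push_cast; ring)
  linarith

lemma eq_zero_of_add_mul_eq_zero [IsDomain R] [Module.Free ℤ R] [Module.Finite ℤ R]
    (h : IsImaginaryQuadratic R d s) (hd : 0 < d) {m n : ℤ}
    (hmn : (m : R) + n * s = 0) : m = 0 ∧ n = 0 := by
  have h1 := h.norm_add_mul m n
  rw [hmn, Algebra.norm_zero] at h1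
  have hd' : (0 : ℤ) < d := by exact_mod_cast hd
  have h2 : n ^ 2 = 0 := by nlinarith [sq_nonneg m, sq_nonneg n]
  have h3 : m ^ 2 = 0 := by nlinarith [sq_nonneg m, sq_nonneg n]
  exact ⟨pow_eq_zero_iff two_ne_zero |>.mp h3, pow_eq_zero_iff two_ne_zero |>.mp h2⟩

lemma two_ne_zero_of_pos [IsDomain R] [Module.Free ℤ R] [Module.Finite ℤ R]
    (h : IsImaginaryQuadratic R d s) (hd : 0 < d) : (2 : R) ≠ 0 := by
  intro h2
  have := (h.eq_zero_of_add_mul_eq_zero hd (m := 2) (n := 0) (by simp [h2])).1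
  norm_num at this

/-- A Minkowski-type bound, from the pigeonhole principle in `ℤ + ℤ s`. -/
lemma exists_small_mem [IsDedekindDomain R] [Module.Free ℤ R] [Module.Finite ℤ R]
    (h : IsImaginaryQuadratic R d s) (hd : 0 < d) {I : Ideal R} (hI : I ≠ ⊥) :
    ∃ β ∈ I, β ≠ 0 ∧ ((Algebra.norm ℤ β).natAbs : ℝ) ≤ 2 * Ideal.absNorm I * √d := by
  have : Finite (R ⧸ I) := Ideal.finiteQuotientOfFreeOfNeBot I hI
  have := Fintype.ofFinite (R ⧸ I)
  set a := Ideal.absNorm I with ha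
  have hcard : Fintype.card (R ⧸ I) = a := by
    rw [ha, Ideal.absNorm_apply, Submodule.cardQuot_apply, Nat.card_eq_fintype_card]
  have hr : 0 < √(d : ℝ) := Real.sqrt_pos.mpr (by exact_mod_cast hd)
  have hrr : √(d : ℝ) * √d = d := Real.mul_self_sqrt (Nat.cast_nonneg d)
  set r := √(d : ℝ)
  set A := ⌊√(a * r)⌋₊
  set B := ⌊√(a / r)⌋₊
  have hA2 : (A : ℝ) ^ 2 ≤ a * r := by
    have := Nat.floor_le (Real.sqrt_nonneg (a * r))
    calc (A : ℝ) ^ 2 ≤ √(a * r) ^ 2 := by gcongr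
      _ = a * r := Real.sq_sqrt (by positivity)
  have hB2 : (B : ℝ) ^ 2 ≤ a / r := by
    have := Nat.floor_le (Real.sqrt_nonneg (a / r))
    calc (B : ℝ) ^ 2 ≤ √(a / r) ^ 2 := by gcongr
      _ = a / r := Real.sq_sqrt (by positivity)
  have hlt : a < (A + 1) * (B + 1) := by
    have h1 : √(a * r) < A + 1 := Nat.lt_floor_add_one _
    have h2 : √(a / r) < B + 1 := Nat.lt_floor_add_one _
    have h3 : √(a * r) * √(a / r) = a := by
      rw [← Real.sqrt_mul (by positivity), show (a : ℝ) * r * (a / r) = a * a by field_simp,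
        Real.sqrt_mul_self (Nat.cast_nonneg a)]
    have : (a : ℝ) < (A + 1) * (B + 1) := by
      rw [← h3]
      exact mul_lt_mul'' h1 h2 (Real.sqrt_nonneg _) (Real.sqrt_nonneg _)
    exact_mod_cast this
  obtain ⟨x, y, hxy, hfxy⟩ := Fintype.exists_ne_map_eq_of_card_lt
    (fun x : Fin (A + 1) × Fin (B + 1) =>
      Ideal.Quotient.mk I ((((x.1 : ℕ) : ℤ) : R) + (((x.2 : ℕ) : ℤ) : R) * s))
    (by simpa [hcard] using hlt)
  set m : ℤ := (x.1 : ℕ) - (y.1 : ℕ) with hm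
  set n : ℤ := (x.2 : ℕ) - (y.2 : ℕ) with hn
  have hmA : |m| ≤ A := by rw [abs_le]; omega
  have hnB : |n| ≤ B := by rw [abs_le]; omega
  refine ⟨(m : R) + n * s, ?_, ?_, ?_⟩
  · have := Ideal.Quotient.eq.mp hfxy
    convert this using 1
    rw [hm, hn]; push_cast; ring
  · intro h0
    obtain ⟨h1, h2⟩ := h.eq_zero_of_add_mul_eq_zero hd h0
    exact hxy (Prod.ext (Fin.ext (by omega)) (Fin.ext (by omega)))
  · rw [h.norm_add_mul, Nat.cast_natAbs, abs_of_nonneg (by positivity)]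
    push_cast
    have h1 : (m : ℝ) ^ 2 ≤ A ^ 2 := by
      rw [sq_le_sq, abs_of_nonneg (Nat.cast_nonneg A : (0 : ℝ) ≤ A)]; exact_mod_cast hmA
    have h2 : (n : ℝ) ^ 2 ≤ B ^ 2 := by
      rw [sq_le_sq, abs_of_nonneg (Nat.cast_nonneg B : (0 : ℝ) ≤ B)]; exact_mod_cast hnB
    calc (m : ℝ) ^ 2 + d * (n : ℝ) ^ 2 ≤ a * r + d * (a / r) := by gcongr <;> linarith
      _ = 2 * a * r := by rw [← hrr]; field_simp; ring

/-- Every ideal class contains an ideal of norm at most `2 √d`. -/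
lemma exists_mk0_eq_absNorm_le [IsDedekindDomain R] [Module.Free ℤ R] [Module.Finite ℤ R]
    (h : IsImaginaryQuadratic R d s) (hd : 0 < d) (C : ClassGroup R) :
    ∃ J : nonZeroDivisors (Ideal R), ClassGroup.mk0 J = C ∧
      (Ideal.absNorm (J : Ideal R) : ℝ) ≤ 2 * √d := by
  obtain ⟨I, hI⟩ := ClassGroup.mk0_surjective C⁻¹
  have hI0 : (I : Ideal R) ≠ ⊥ := nonZeroDivisors.coe_ne_zero I
  obtain ⟨β, hβI, hβ0, hβ⟩ := h.exists_small_mem hd hI0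
  obtain ⟨J, hJ⟩ := Ideal.dvd_span_singleton.mpr hβI
  have hJ0 : J ≠ ⊥ := by
    rintro rfl
    rw [Ideal.mul_bot, Ideal.span_singleton_eq_bot] at hJ
    exact hβ0 hJ
  refine ⟨⟨J, mem_nonZeroDivisors_of_ne_zero hJ0⟩, ?_, ?_⟩
  · have : ClassGroup.mk0 (I * ⟨J, mem_nonZeroDivisors_of_ne_zero hJ0⟩) = 1 := by
      rw [ClassGroup.mk0_eq_one_iff]
      exact ⟨β, hJ.symm⟩
    rw [map_mul, hI] at this
    exact (inv_mul_eq_one.mp this).symm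
  · have h1 := congrArg Ideal.absNorm hJ
    rw [Ideal.absNorm_span_singleton, map_mul] at h1
    rw [h1] at hβ
    have hpos : (0 : ℝ) < Ideal.absNorm (I : Ideal R) := by
      exact_mod_cast Nat.pos_of_ne_zero (mt Ideal.absNorm_eq_zero_iff.mp hI0)
    push_cast at hβ
    change (Ideal.absNorm J : ℝ) ≤ _
    nlinarith

/-- The ring `R` has a `ℤ`-basis of the form `1, ω`. -/
lemma exists_omega [IsDomain R] [Module.Free ℤ R] [Module.Finite ℤ R]
    (h : IsImaginaryQuadratic R d s) (hd : 0 < d) :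
    ∃ (ω : R) (u v : ℤ), (u = 0 ∨ u = 1) ∧ (v = 1 ∨ v = 2) ∧ 2 * ω = u + v * s ∧
      ∀ x : R, ∃ m n : ℤ, x = m + n * ω := by
  have h2 := h.two_ne_zero_of_pos hd
  have half : ∀ (x : R) (u : ℤ), 2 * x = u → ∃ m : ℤ, x = m := by
    intro x u hx
    have h1 := h.norm_eq x u 0 (by rw [hx]; simp)
    have h3 : Even (u ^ 2) := ⟨2 * Algebra.norm ℤ x, by linarith⟩
    obtain ⟨k, rfl⟩ := (Int.even_pow' two_ne_zero).mp h3
    refine ⟨k, mul_left_cancel₀ h2 ?_⟩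
    rw [hx]; push_cast; ring
  by_cases hodd : ∃ (x : R) (u v : ℤ), 2 * x = u + v * s ∧ Odd v
  · obtain ⟨x, u, v, hx, k, rfl⟩ := hodd
    refine ⟨x - k * s - (u / 2 : ℤ), u % 2, 1, by omega, Or.inl rfl, ?_, ?_⟩
    · have h1 : ((u % 2 : ℤ) : R) = u - 2 * ((u / 2 : ℤ) : R) := by
        have : u % 2 = u - 2 * (u / 2) := by omega
        rw [this]; push_cast; ring
      rw [h1, mul_sub, mul_sub, hx]; push_cast; ring
    · intro y
      obtain ⟨u', v', hy⟩ := h.exists_rep y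
      set ω := x - k * s - (u / 2 : ℤ)
      have hω : 2 * ω = (u - 2 * (u / 2) : ℤ) + s := by
        rw [mul_sub, mul_sub, hx]; push_cast; ring
      obtain ⟨m, hm⟩ := half (y - v' * ω) (u' - v' * (u - 2 * (u / 2)))
        (by rw [mul_sub, hy, mul_left_comm, hω]; push_cast; ring)
      exact ⟨m, v', by rw [← hm]; ring⟩
  · push Not at hodd
    refine ⟨s, 0, 2, Or.inl rfl, Or.inr rfl, by simp, ?_⟩
    intro y
    obtain ⟨u', v', hy⟩ := h.exists_rep y
    obtain ⟨k, rfl⟩ := Int.not_odd_iff_even.mp (hodd y u' v' hy)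
    obtain ⟨m, hm⟩ := half (y - k * s) u' (by rw [mul_sub, hy]; push_cast; ring)
    exact ⟨m, k, by rw [← hm]; ring⟩

end IsImaginaryQuadratic

/-- If the integers surject onto `R ⧸ I`, they meet `I` in the multiples of the norm of `I`. -/
lemma Ideal.intCast_mem_iff_absNorm_dvd {R : Type*} [CommRing R] [IsDedekindDomain R]
    [Module.Free ℤ R] {I : Ideal R} (hI : ∀ x : R, ∃ m : ℤ, x - m ∈ I) (k : ℤ) :
    (k : R) ∈ I ↔ (Ideal.absNorm I : ℤ) ∣ k := by
  have hgen : ∀ x : R ⧸ I, x ∈ AddSubgroup.zmultiples (1 : R ⧸ I) := by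
    intro x
    obtain ⟨x, rfl⟩ := Ideal.Quotient.mk_surjective x
    obtain ⟨m, hm⟩ := hI x
    refine ⟨m, ?_⟩
    have := Ideal.Quotient.eq.mpr hm
    simp [this]
  have hord : addOrderOf (1 : R ⧸ I) = Ideal.absNorm I := by
    rw [addOrderOf_eq_card_of_forall_mem_zmultiples hgen, Ideal.absNorm_apply,
      Submodule.cardQuot_apply]
  rw [← hord, addOrderOf_dvd_iff_zsmul_eq_zero, ← Ideal.Quotient.eq_zero_iff_mem]
  simp

namespace IsImaginaryQuadratic

variable {R : Type*} [CommRing R] [IsDedekindDomain R] [Module.Free ℤ R] [Module.Finite ℤ R]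
  {d : ℕ} {s : R}

/-- A nonzero ideal of least norm in its class is not divisible by an integer, hence contains some
`b + ω`. -/
lemma exists_intCast_add_mem_of_minimal {ω : R} (hω : ∀ x : R, ∃ m n : ℤ, x = m + n * ω)
    (J : nonZeroDivisors (Ideal R))
    (hmin : ∀ J' : nonZeroDivisors (Ideal R), ClassGroup.mk0 J' = ClassGroup.mk0 J →
      Ideal.absNorm (J : Ideal R) ≤ Ideal.absNorm (J' : Ideal R)) :
    ∃ b : ℤ, (b : R) + ω ∈ (J : Ideal R) := by
  have hJ0 : (J : Ideal R) ≠ ⊥ := nonZeroDivisors.coe_ne_zero J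
  let S : AddSubgroup ℤ :=
    { carrier := {n | ∃ m : ℤ, (m : R) + n * ω ∈ (J : Ideal R)}
      zero_mem' := ⟨0, by simp⟩
      add_mem' := by
        rintro n n' ⟨m, hm⟩ ⟨m', hm'⟩
        refine ⟨m + m', ?_⟩
        convert add_mem hm hm' using 1
        push_cast; ring
      neg_mem' := by
        rintro n ⟨m, hm⟩
        refine ⟨-m, ?_⟩
        convert neg_mem hm using 1
        push_cast; ring }
  obtain ⟨c, hc⟩ := Int.subgroup_cyclic S
  have hS : ∀ n, n ∈ S ↔ c ∣ n := by
    intro n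
    rw [hc, AddSubgroup.mem_closure_singleton]
    simp only [smul_eq_mul, Dvd.dvd, mul_comm, eq_comm]
  obtain ⟨r, t, hrt⟩ := hω (ω * ω)
  have hle : ∀ x ∈ (J : Ideal R), ((c : ℤ) : R) ∣ x := by
    intro x hx
    obtain ⟨m, n, rfl⟩ := hω x
    have hn : c ∣ n := (hS n).mp ⟨m, hx⟩
    have hm : c ∣ m + n * t := by
      refine (hS _).mp ⟨n * r, ?_⟩
      convert (J : Ideal R).mul_mem_left ω hx using 1
      push_cast
      linear_combination -(n : R) * hrt
    have hm' : c ∣ m := (dvd_add_left (hn.mul_right t)).mp hm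
    exact dvd_add (map_dvd (Int.castRingHom R) hm') ((map_dvd (Int.castRingHom R) hn).mul_right ω)
  have hdvd : Ideal.span {(c : R)} ∣ (J : Ideal R) := by
    rw [Ideal.dvd_iff_le]
    exact fun x hx => Ideal.mem_span_singleton.mpr (hle x hx)
  obtain ⟨J', hJ'⟩ := hdvd
  have hJ'0 : J' ≠ ⊥ := by
    rintro rfl
    exact hJ0 (by rw [hJ', Ideal.mul_bot])
  have hc0 : (c : R) ≠ 0 := by
    intro h0
    exact hJ0 (by rw [hJ', h0, Ideal.span_singleton_eq_bot.mpr rfl, Ideal.bot_mul])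
  have hmk : ClassGroup.mk0 ⟨J', mem_nonZeroDivisors_of_ne_zero hJ'0⟩ = ClassGroup.mk0 J := by
    rw [ClassGroup.mk0_eq_mk0_iff]
    exact ⟨c, 1, hc0, one_ne_zero, by simp [hJ']⟩
  have h1 := hmin _ hmk
  have h2 := congrArg Ideal.absNorm hJ'
  rw [map_mul] at h2
  have hpos : 0 < Ideal.absNorm J' := Nat.pos_of_ne_zero (mt Ideal.absNorm_eq_zero_iff.mp hJ'0)
  have h3 : Ideal.absNorm (Ideal.span {(c : R)}) ≤ 1 := by
    rw [h2] at h1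
    change _ * Ideal.absNorm J' ≤ Ideal.absNorm J' at h1
    by_contra! h4
    nlinarith
  have h4 : Ideal.absNorm (Ideal.span {(c : R)}) ≠ 0 := by
    rw [Ne, Ideal.absNorm_eq_zero_iff, Ideal.span_singleton_eq_bot]
    exact hc0
  have h5 : Ideal.span {(c : R)} = ⊤ := Ideal.absNorm_eq_one_iff.mp (by omega)
  rw [h5, Ideal.top_mul] at hJ'
  have hunit : c ∣ 1 := by
    have h6 := Ideal.absNorm_span_singleton (c : R)
    rw [h5, Ideal.absNorm_top] at h6
    have h7 : Algebra.norm ℤ (c : R) = c ^ Module.finrank ℤ R := by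
      simpa using Algebra.norm_algebraMap (S := R) c
    have h8 : IsUnit (c ^ Module.finrank ℤ R) := by
      rw [← h7, Int.isUnit_iff_natAbs_eq]; exact h6.symm
    have : Nontrivial R := inferInstance
    exact isUnit_iff_dvd_one.mp ((isUnit_pow_iff Module.finrank_pos.ne').mp h8)
  obtain ⟨b, hb⟩ := (hS 1).mpr hunit
  exact ⟨b, by simpa using hb⟩

/-- A bound for the class number in terms of a bound for the divisor function. -/
theorem card_classGroup_le (h : IsImaginaryQuadratic R d s) (hd : 0 < d) {T : ℝ}
    (hT : ∀ n : ℕ, 0 < n → n ≤ 8 * d → (n.divisors.card : ℝ) ≤ T) :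
    (Nat.card (ClassGroup R) : ℝ) ≤ (2 * √d + 1) * T := by
  obtain ⟨ω, u, v, hu, hv, hω, hrep⟩ := h.exists_omega hd
  have hd1 : (1 : ℝ) ≤ d := by exact_mod_cast hd
  have hr1 : 1 ≤ √(d : ℝ) := Real.one_le_sqrt.mpr hd1
  have hrr : √(d : ℝ) * √d = d := Real.mul_self_sqrt (Nat.cast_nonneg d)
  have hmin : ∀ C : ClassGroup R, ∃ J : nonZeroDivisors (Ideal R), ClassGroup.mk0 J = C ∧
      ∀ J' : nonZeroDivisors (Ideal R), ClassGroup.mk0 J' = C →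
        Ideal.absNorm (J : Ideal R) ≤ Ideal.absNorm (J' : Ideal R) := by
    intro C
    have hne : {J : nonZeroDivisors (Ideal R) | ClassGroup.mk0 J = C}.Nonempty :=
      ClassGroup.mk0_surjective C
    refine ⟨Function.argminOn (fun J => Ideal.absNorm (J : Ideal R)) _ hne,
      Function.argminOn_mem (fun J : nonZeroDivisors (Ideal R) => Ideal.absNorm (J : Ideal R)) _
        hne,
      fun J' hJ' => ?_⟩
    exact Function.argminOn_le (fun J : nonZeroDivisors (Ideal R) => Ideal.absNorm (J : Ideal R))
      _ hJ'
  choose J hJ hJmin using hmin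
  have hJle : ∀ C, (Ideal.absNorm (J C : Ideal R) : ℝ) ≤ 2 * √d := by
    intro C
    obtain ⟨J', h1, h2⟩ := h.exists_mk0_eq_absNorm_le hd C
    exact le_trans (by exact_mod_cast hJmin C J' h1) h2
  have hJpos : ∀ C, 0 < Ideal.absNorm (J C : Ideal R) := fun C =>
    Nat.pos_of_ne_zero (mt Ideal.absNorm_eq_zero_iff.mp (nonZeroDivisors.coe_ne_zero _))
  have hb : ∀ C, ∃ b : ℕ, b < Ideal.absNorm (J C : Ideal R) ∧
      ((b : ℤ) : R) + ω ∈ (J C : Ideal R) := by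
    intro C
    obtain ⟨b, hb⟩ := exists_intCast_add_mem_of_minimal hrep (J C)
      (fun J' hJ' => hJmin C J' (hJ'.trans (hJ C)))
    set a := Ideal.absNorm (J C : Ideal R)
    have ha : (0 : ℤ) < a := by exact_mod_cast hJpos C
    refine ⟨(b % a).toNat, ?_, ?_⟩
    · have := Int.emod_lt_of_pos b ha
      have := Int.emod_nonneg b ha.ne'
      omega
    · rw [Int.toNat_of_nonneg (Int.emod_nonneg b ha.ne')]
      have h1 : ((b % a : ℤ) : R) + ω = (b + ω) - (b / a : ℤ) * ((a : ℤ) : R) := by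
        rw [Int.emod_def]; push_cast; ring
      rw [h1]
      refine sub_mem hb (Ideal.mul_mem_left _ _ ?_)
      rw [Int.cast_natCast]
      exact Ideal.absNorm_mem _
  choose b hba hbmem using hb
  have hsurj : ∀ C, ∀ x : R, ∃ m : ℤ, x - m ∈ (J C : Ideal R) := by
    intro C x
    obtain ⟨m, n, rfl⟩ := hrep x
    refine ⟨m - n * b C, ?_⟩
    convert (J C : Ideal R).mul_mem_left (n : R) (hbmem C) using 1
    push_cast; ring
  have hmem : ∀ C (m n : ℤ), (m : R) + n * ω ∈ (J C : Ideal R) ↔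
      (Ideal.absNorm (J C : Ideal R) : ℤ) ∣ m - n * b C := by
    intro C m n
    rw [← Ideal.intCast_mem_iff_absNorm_dvd (hsurj C)]
    have h1 : (m : R) + n * ω = ((m - n * b C : ℤ) : R) + n * (((b C : ℤ) : R) + ω) := by
      push_cast; ring
    rw [h1]
    exact Submodule.add_mem_iff_left _ (Ideal.mul_mem_left _ _ (hbmem C))
  set F : ℕ → ℕ := fun b => (Algebra.norm ℤ (((b : ℤ) : R) + ω)).natAbs
  have hF : ∀ b : ℕ, (4 * F b : ℤ) = (2 * b + u) ^ 2 + d * v ^ 2 := by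
    intro b
    have h1 := h.norm_eq ((b : ℤ) + ω) (2 * b + u) v (by rw [mul_add, hω]; push_cast; ring)
    have h2 : 0 ≤ Algebra.norm ℤ (((b : ℤ) : R) + ω) := by
      have : (0 : ℤ) ≤ (2 * b + u) ^ 2 + d * v ^ 2 := by positivity
      linarith
    rw [← h1, show ((F b : ℕ) : ℤ) = _ from Int.natAbs_of_nonneg h2]
  have hFpos : ∀ b, 0 < F b := by
    intro b
    have hd' : (0 : ℤ) < d := by exact_mod_cast hd
    have : (0 : ℤ) < (2 * b + u) ^ 2 + d * v ^ 2 := by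
      have : 0 < v ^ 2 := by rcases hv with rfl | rfl <;> norm_num
      positivity
    have := hF b
    omega
  set B := ⌊2 * √(d : ℝ)⌋₊
  have hFle : ∀ b ≤ B, F b ≤ 8 * d := by
    intro b hb
    have hb' : (b : ℝ) ≤ 2 * √d := (Nat.le_floor_iff (by positivity)).mp hb
    have h1 : (4 * F b : ℝ) = (2 * b + u) ^ 2 + d * v ^ 2 := by exact_mod_cast hF b
    have h2 : (F b : ℝ) ≤ 8 * d := by
      have hb0 : (0 : ℝ) ≤ b := Nat.cast_nonneg b
      have hu1 : (0 : ℝ) ≤ u ∧ (u : ℝ) ≤ 1 := by rcases hu with rfl | rfl <;> norm_num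
      have hv1 : (v : ℝ) ^ 2 ≤ 4 := by rcases hv with rfl | rfl <;> norm_num
      have h3 : (2 * (b : ℝ) + u) ≤ 5 * √d := by linarith [hu1.2]
      have h4 : (2 * (b : ℝ) + u) ^ 2 ≤ (5 * √d) ^ 2 := by
        have := hu1.1
        gcongr
      nlinarith
    exact_mod_cast h2
  have hinj : Function.Injective
      (fun C => (⟨b C, Ideal.absNorm (J C : Ideal R)⟩ : Σ _ : ℕ, ℕ)) := by
    intro C C' hCC
    simp only [Sigma.mk.injEq, heq_eq_eq] at hCC
    have : J C = J C' := by
      ext x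
      obtain ⟨m, n, rfl⟩ := hrep x
      rw [hmem, hmem, hCC.1, hCC.2]
    rw [← hJ C, ← hJ C', this]
  have hmaps : ∀ C, (⟨b C, Ideal.absNorm (J C : Ideal R)⟩ : Σ _ : ℕ, ℕ) ∈
      (Finset.range (B + 1)).sigma (fun b => (F b).divisors) := by
    intro C
    rw [Finset.mem_sigma, Finset.mem_range, Nat.mem_divisors]
    refine ⟨?_, ?_, (hFpos _).ne'⟩
    · have : Ideal.absNorm (J C : Ideal R) ≤ B := Nat.le_floor (hJle C)
      have := hba C
      change b C < B + 1
      omega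
    · change _ ∣ (Algebra.norm ℤ (((b C : ℤ) : R) + ω)).natAbs
      rw [← Ideal.absNorm_span_singleton]
      exact Ideal.absNorm_dvd_absNorm_of_le
        ((Ideal.span_singleton_le_iff_mem _).mpr (hbmem C))
  have hcard : Nat.card (ClassGroup R) ≤
      ((Finset.range (B + 1)).sigma (fun b => (F b).divisors)).card := by
    rw [← Fintype.card_coe, ← Nat.card_eq_fintype_card]
    refine Nat.card_le_card_of_injective (fun C => ⟨_, hmaps C⟩) fun C C' hCC => hinj ?_
    exact congrArg Subtype.val hCC
  rw [Finset.card_sigma] at hcard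
  have hT0 : 0 ≤ T := le_trans (Nat.cast_nonneg _) (hT 1 one_pos (by omega))
  calc (Nat.card (ClassGroup R) : ℝ) ≤ ∑ b ∈ Finset.range (B + 1), ((F b).divisors.card : ℝ) := by
        exact_mod_cast hcard
    _ ≤ ∑ b ∈ Finset.range (B + 1), T := by
        refine Finset.sum_le_sum fun b hb => hT _ (hFpos b) (hFle b ?_)
        rw [Finset.mem_range] at hb; omega
    _ = (B + 1) * T := by simp
    _ ≤ (2 * √d + 1) * T := by
        gcongr
        exact Nat.floor_le (by positivity)

/-- There is an ideal of norm `p` above each odd prime `p` modulo which `-d` is a square. -/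
theorem exists_absNorm_eq_prime (h : IsImaginaryQuadratic R d s) (hd : 0 < d) {p : ℕ}
    (hp : p.Prime) (hp2 : p ≠ 2) {b : ℤ} (hb : (p : ℤ) ∣ b ^ 2 + d) :
    ∃ P : nonZeroDivisors (Ideal R), Ideal.absNorm (P : Ideal R) = p := by
  set P : Ideal R := Ideal.span {((p : ℤ) : R), (b : R) + s}
  have hpP : ((p : ℤ) : R) ∈ P := Ideal.subset_span (by simp)
  have hbP : (b : R) + s ∈ P := Ideal.subset_span (by simp)
  have hodd : Odd p := hp.odd_of_ne_two hp2
  obtain ⟨k, hk⟩ := hodd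
  have hsurj : ∀ x : R, ∃ m : ℤ, x - m ∈ P := by
    intro x
    obtain ⟨u, v, hx⟩ := h.exists_rep x
    refine ⟨-(k * (u - v * b)), ?_⟩
    have h1 : x - ((-(k * (u - v * b)) : ℤ) : R) =
        x * ((p : ℤ) : R) - (k * v : ℤ) * (b + s) := by
      rw [hk]; push_cast; linear_combination -(k : R) * hx
    rw [h1]
    exact sub_mem (P.mul_mem_left _ hpP) (P.mul_mem_left _ hbP)
  have hp0 : ((p : ℤ) : R) ≠ 0 := by
    intro h0
    have := (h.eq_zero_of_add_mul_eq_zero hd (m := p) (n := 0) (by simpa using h0)).1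
    exact hp.ne_zero (by exact_mod_cast this)
  have hP0 : P ≠ ⊥ := fun h0 => hp0 (by rw [h0] at hpP; exact hpP)
  refine ⟨⟨P, mem_nonZeroDivisors_of_ne_zero hP0⟩, ?_⟩
  change Ideal.absNorm P = p
  have hdvd : Ideal.absNorm P ∣ p := by
    exact_mod_cast (Ideal.intCast_mem_iff_absNorm_dvd hsurj p).mp hpP
  refine ((Nat.dvd_prime hp).mp hdvd).resolve_left fun h1 => ?_
  rw [Ideal.absNorm_eq_one_iff, Ideal.eq_top_iff_one, Ideal.mem_span_pair] at h1
  obtain ⟨x, y, hxy⟩ := h1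
  obtain ⟨c, hc⟩ := hb
  have hcR : (b : R) ^ 2 + d = ((p : ℤ) : R) * c := by
    exact_mod_cast congrArg (Int.cast (R := R)) hc
  obtain ⟨u, v, huv⟩ := h.exists_rep (x * (b - s) + c * y)
  have h2 : ((2 * b - p * u : ℤ) : R) + ((-2 - p * v : ℤ) : R) * s = 0 := by
    push_cast
    push_cast at huv hxy hcR
    linear_combination (p : R) * huv - 2 * (b - s) * hxy - 2 * y * h.sq_eq + 2 * y * hcR
  have h3 := (h.eq_zero_of_add_mul_eq_zero hd h2).2
  have h4 : (p : ℤ) ∣ 2 := ⟨-v, by linarith⟩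
  have h5 : p ∣ 2 := by exact_mod_cast h4
  exact hp2 ((Nat.prime_dvd_prime_iff_eq hp Nat.prime_two).mp h5)

/-- If ideals of distinct prime norms `p, q` have classes with the same `g`-th power, then
`4 (p q) ^ g` is represented by `u ^ 2 + d v ^ 2` with `v ≠ 0`. -/
theorem exists_sq_add_mul_sq_of_mk0_pow_eq (h : IsImaginaryQuadratic R d s) {g p q : ℕ}
    (hg : Odd g) (hp : p.Prime) (hq : q.Prime) (hpq : p ≠ q)
    {P Q : nonZeroDivisors (Ideal R)} (hP : Ideal.absNorm (P : Ideal R) = p)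
    (hQ : Ideal.absNorm (Q : Ideal R) = q)
    (hPQ : ClassGroup.mk0 P ^ g = ClassGroup.mk0 Q ^ g) :
    ∃ u v : ℤ, v ≠ 0 ∧ u ^ 2 + d * v ^ 2 = 4 * ((p * q) ^ g : ℕ) := by
  rw [← map_pow, ← map_pow, ClassGroup.mk0_eq_mk0_iff] at hPQ
  obtain ⟨x, y, hx, hy, hxy⟩ := hPQ
  rw [SubmonoidClass.coe_pow, SubmonoidClass.coe_pow] at hxy
  have hmem : y * ((q : R) ^ g) ∈ Ideal.span {x} * (P : Ideal R) ^ g := by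
    rw [hxy]
    refine Ideal.mul_mem_mul (Ideal.mem_span_singleton_self y) (Ideal.pow_mem_pow ?_ g)
    rw [← hQ]; exact Ideal.absNorm_mem _
  obtain ⟨α, hα, hyα⟩ := Ideal.mem_span_singleton_mul.mp hmem
  have hN := congrArg Ideal.absNorm hxy
  simp only [map_mul, map_pow, hP, hQ, Ideal.absNorm_span_singleton] at hN
  have hN2 := congrArg (fun z => (Algebra.norm ℤ z).natAbs) hyα
  simp only [map_mul, Int.natAbs_mul, map_pow, Int.natAbs_pow] at hN2
  have hNq : (Algebra.norm ℤ (q : R)).natAbs = q ^ 2 := by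
    have := h.norm_add_mul q 0
    simp only [Int.cast_natCast, Int.cast_zero, zero_mul, add_zero] at this
    rw [this]; simp [Int.natAbs_pow]
  rw [hNq] at hN2
  have hx0 : 0 < (Algebra.norm ℤ x).natAbs :=
    Int.natAbs_pos.mpr (Algebra.norm_ne_zero_iff.mpr hx)
  have hαN : (Algebra.norm ℤ α).natAbs = (p * q) ^ g := by
    have : (Algebra.norm ℤ x).natAbs * (Algebra.norm ℤ α).natAbs =
        (Algebra.norm ℤ x).natAbs * (p * q) ^ g := by
      rw [hN2, mul_pow, ← mul_assoc, hN]; ring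
    exact Nat.eq_of_mul_eq_mul_left hx0 this
  obtain ⟨u, v, huv⟩ := h.exists_rep α
  have h4 := h.norm_eq α u v huv
  have hα0 : 0 ≤ Algebra.norm ℤ α := by
    have : (0 : ℤ) ≤ u ^ 2 + d * v ^ 2 := by positivity
    linarith
  have h5 : Algebra.norm ℤ α = ((p * q) ^ g : ℕ) := by
    rw [← hαN, Int.natAbs_of_nonneg hα0]
  refine ⟨u, v, ?_, by rw [← h4, h5]⟩
  rintro rfl
  rw [h5] at h4
  have h6 : 4 * (p * q) ^ g = u.natAbs ^ 2 := by
    zify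
    rw [sq_abs]
    push_cast at h4
    linarith
  have : Fact p.Prime := ⟨hp⟩
  have h7 := congrArg (padicValNat p) h6
  have hu0 : u.natAbs ≠ 0 := by
    rintro h0
    rw [h0] at h6
    have := pow_pos (Nat.mul_pos hp.pos hq.pos) g
    omega
  have hpq0 : p * q ≠ 0 := (Nat.mul_pos hp.pos hq.pos).ne'
  rw [padicValNat.mul (by norm_num) (pow_ne_zero _ hpq0), padicValNat.pow,
    padicValNat.pow, padicValNat.mul hp.ne_zero hq.ne_zero,
    padicValNat_self, show (4 : ℕ) = 2 ^ 2 by norm_num, padicValNat.pow,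
    padicValNat.eq_zero_of_not_dvd (mt (Nat.prime_dvd_prime_iff_eq hp hq).mp hpq)] at h7
  obtain ⟨k, rfl⟩ := hg
  omega

end IsImaginaryQuadratic

/-- The torsion bound behind the Ellenberg–Venkatesh method. -/
lemma card_torsion_mul_card_sq_le {G ι : Type*} [CommGroup G] [Finite G] [DecidableEq G]
    (g : ℕ) (S : Finset ι) (φ : ι → G) :
    Nat.card {c : G // c ^ g = 1} * S.card ^ 2 ≤
      Nat.card G * ((S ×ˢ S).filter fun x => φ x.1 ^ g = φ x.2 ^ g).card := by
  classical
  have := Fintype.ofFinite G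
  set f : G →* G := powMonoidHom g
  have hker : Nat.card G = Nat.card f.range * Nat.card {c : G // c ^ g = 1} := by
    rw [Subgroup.card_eq_card_quotient_mul_card_subgroup f.ker,
      Nat.card_congr (QuotientGroup.quotientKerEquivRange f).toEquiv]
    rfl
  set T : Finset G := Finset.univ.filter fun c => c ∈ f.range
  have hT : T.card = Nat.card f.range := by
    rw [Nat.card_eq_fintype_card, Fintype.card_subtype]
  have hmaps : ∀ i ∈ S, φ i ^ g ∈ T := by
    intro i _
    rw [Finset.mem_filter]
    exact ⟨Finset.mem_univ _, φ i, rfl⟩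
  have h1 : S.card = ∑ c ∈ T, (S.filter fun i => φ i ^ g = c).card :=
    Finset.card_eq_sum_card_fiberwise hmaps
  have h2 : ((S ×ˢ S).filter fun x => φ x.1 ^ g = φ x.2 ^ g).card =
      ∑ c ∈ T, (S.filter fun i => φ i ^ g = c).card ^ 2 := by
    rw [Finset.card_eq_sum_card_fiberwise (f := fun x => φ x.1 ^ g) (t := T)]
    · refine Finset.sum_congr rfl fun c _ => ?_
      rw [sq, ← Finset.card_product]
      congr 1
      ext x
      simp only [Finset.mem_filter, Finset.mem_product]
      constructor
      · rintro ⟨⟨⟨h1, h2⟩, h3⟩, h4⟩; exact ⟨⟨h1, h4⟩, h2, h3 ▸ h4⟩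
      · rintro ⟨⟨h1, h2⟩, h3, h4⟩; exact ⟨⟨⟨h1, h3⟩, h2.trans h4.symm⟩, h2⟩
    · intro x hx
      simp only [Finset.coe_filter, Finset.mem_product, Set.mem_ofPred_eq] at hx
      exact hmaps _ hx.1.1
  have h3 := sq_sum_le_card_mul_sum_sq (s := T) (f := fun c => (S.filter fun i => φ i ^ g = c).card)
  rw [← h1, ← h2, hT] at h3
  rw [hker]
  calc _ ≤ Nat.card {c : G // c ^ g = 1} * (Nat.card f.range *
        ((S ×ˢ S).filter fun x => φ x.1 ^ g = φ x.2 ^ g).card) := Nat.mul_le_mul_left _ h3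
    _ = _ := by ring

/-- `4 n = u ^ 2 + d v ^ 2` has an integer solution with `v ≠ 0`. -/
def IsRepresented (d n : ℕ) : Prop :=
  ∃ u v : ℤ, v ≠ 0 ∧ u ^ 2 + d * v ^ 2 = 4 * (n : ℤ)

open Classical in
theorem hneg_mul_card_sq_le {g d : ℕ} (hg : Odd g) (hd : 0 < d) (hsq : Squarefree d)
    (P S : Finset ℕ) (hSP : S ⊆ P)
    (hS : ∀ p ∈ S, p.Prime ∧ p ≠ 2 ∧ ∃ b : ℤ, (p : ℤ) ∣ b ^ 2 + d) :
    hneg g d * S.card ^ 2 ≤ Nat.card (ClassGroup (NumberField.RingOfIntegers (Kneg d))) *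
      (S.card + (P.offDiag.filter fun x => IsRepresented d ((x.1 * x.2) ^ g)).card) := by
  have := numberField_kneg hd
  obtain ⟨s, h⟩ := exists_isImaginaryQuadratic_kneg hd hsq
  have hI : ∀ p : ℕ, ∃ I : nonZeroDivisors (Ideal (NumberField.RingOfIntegers (Kneg d))),
      p ∈ S → Ideal.absNorm (I : Ideal (NumberField.RingOfIntegers (Kneg d))) = p := by
    intro p
    by_cases hp : p ∈ S
    · obtain ⟨hp1, hp2, b, hb⟩ := hS p hp
      obtain ⟨I, hI⟩ := h.exists_absNorm_eq_prime hd hp1 hp2 hb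
      exact ⟨I, fun _ => hI⟩
    · exact ⟨1, fun h => absurd h hp⟩
  choose I hI using hI
  refine (card_torsion_mul_card_sq_le g S fun p => ClassGroup.mk0 (I p)).trans
    (Nat.mul_le_mul_left _ ?_)
  rw [← Finset.diag_card S]
  refine (Finset.card_le_card ?_).trans (Finset.card_union_le _ _)
  intro x hx
  simp only [Finset.mem_filter, Finset.mem_product] at hx
  obtain ⟨⟨h1, h2⟩, h3⟩ := hx
  rw [Finset.mem_union, Finset.mem_diag, Finset.mem_filter, Finset.mem_offDiag]
  by_cases hx : x.1 = x.2
  · exact Or.inl ⟨h1, hx⟩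
  · exact Or.inr ⟨⟨hSP h1, hSP h2, hx⟩, h.exists_sq_add_mul_sq_of_mk0_pow_eq hg (hS _ h1).1
      (hS _ h2).1 hx (hI _ h1) (hI _ h2) h3⟩

theorem card_classGroup_kneg_le {d : ℕ} (hd : 0 < d) (hsq : Squarefree d) {T : ℝ}
    (hT : ∀ n : ℕ, 0 < n → n ≤ 8 * d → (n.divisors.card : ℝ) ≤ T) :
    (Nat.card (ClassGroup (NumberField.RingOfIntegers (Kneg d))) : ℝ) ≤ (2 * √d + 1) * T := by
  have := numberField_kneg hd
  obtain ⟨s, h⟩ := exists_isImaginaryQuadratic_kneg hd hsq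
  exact h.card_classGroup_le hd hT

lemma hneg_le_card_classGroup {g d : ℕ} (hd : 0 < d) :
    hneg g d ≤ Nat.card (ClassGroup (NumberField.RingOfIntegers (Kneg d))) := by
  have := numberField_kneg hd
  exact Finite.card_subtype_le _

lemma card_le_of_dvd_mul_sub {w : ℕ} (hw : 0 < w) {A L : ℝ} (hL : 0 ≤ L) (k : ℕ) (F : Finset ℤ)
    (hF : ∀ u ∈ F, A ≤ u ∧ (u : ℝ) ≤ A + L)
    (hdvd : ∀ u ∈ F, ∀ u' ∈ F, (w : ℤ) ∣ k * (u - u')) (hk : 0 < k) :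
    (F.card : ℝ) ≤ k * L / w + 1 := by
  rcases F.eq_empty_or_nonempty with rfl | hne
  · simp only [Finset.card_empty, Nat.cast_zero]; positivity
  have hw' : (0 : ℝ) < w := by exact_mod_cast hw
  set m := F.min' hne
  have hm : m ∈ F := F.min'_mem hne
  have hle : ∀ u ∈ F, m ≤ u := fun u hu => F.min'_le u hu
  have hcard : F.card ≤ (Finset.range (⌊k * L / w⌋₊ + 1)).card := by
    refine Finset.card_le_card_of_injOn (fun u => (k * (u - m) / w).toNat) ?_ ?_
    · intro u hu
      rw [Finset.mem_coe, Finset.mem_range, Nat.lt_succ_iff]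
      obtain ⟨c, hc⟩ := hdvd u hu m hm
      have hc0 : 0 ≤ c := by
        have h1 := hle u hu
        have h2 : (0 : ℤ) ≤ k * (u - m) := mul_nonneg (by positivity) (by linarith)
        rw [hc] at h2
        exact nonneg_of_mul_nonneg_right h2 (by exact_mod_cast hw)
      change (k * (u - m) / (w : ℤ)).toNat ≤ _
      rw [hc, Int.mul_ediv_cancel_left _ (by exact_mod_cast hw.ne')]
      refine Nat.le_floor ?_
      rw [le_div_iff₀ hw']
      have h3 : ((w * c : ℤ) : ℝ) = (k : ℝ) * (u - m) := by rw [← hc]; push_cast; ring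
      have h4 : ((c.toNat : ℕ) : ℝ) = (c : ℝ) := by
        exact_mod_cast Int.toNat_of_nonneg hc0
      rw [h4, mul_comm]
      push_cast at h3
      rw [h3]
      have := (hF u hu).2
      have := (hF m hm).1
      gcongr
      linarith
    · intro u hu u' hu' huu
      obtain ⟨c, hc⟩ := hdvd u hu m hm
      obtain ⟨c', hc'⟩ := hdvd u' hu' m hm
      have hwz : (w : ℤ) ≠ 0 := by exact_mod_cast hw.ne'
      have hwz' : (0 : ℤ) < w := by exact_mod_cast hw
      simp only [hc, hc', Int.mul_ediv_cancel_left _ hwz] at huu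
      have hc0 : 0 ≤ c := by
        have h2 : (0 : ℤ) ≤ k * (u - m) := mul_nonneg (by positivity) (by linarith [hle u hu])
        rw [hc] at h2
        exact nonneg_of_mul_nonneg_right h2 hwz'
      have hc0' : 0 ≤ c' := by
        have h2 : (0 : ℤ) ≤ k * (u' - m) := mul_nonneg (by positivity) (by linarith [hle u' hu'])
        rw [hc'] at h2
        exact nonneg_of_mul_nonneg_right h2 hwz'
      have hcc : c = c' := by omega
      have hkz : (k : ℤ) ≠ 0 := by exact_mod_cast hk.ne'
      have : (k : ℤ) * (u - m) = k * (u' - m) := by rw [hc, hc', hcc]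
      have := mul_left_cancel₀ hkz this
      linarith
  rw [Finset.card_range] at hcard
  calc (F.card : ℝ) ≤ (⌊k * L / w⌋₊ : ℝ) + 1 := by exact_mod_cast hcard
    _ ≤ _ := by
      gcongr
      exact Nat.floor_le (by positivity)

/-- Square roots of `4 N` modulo `v ^ 2` in an interval. -/
lemma card_sqrt_mod_le {v N : ℕ} (hv : 0 < v) (hcop : v.Coprime N) {A L : ℝ} (hL : 0 ≤ L)
    (U : Finset ℤ) (hU : ∀ u ∈ U, A ≤ u ∧ (u : ℝ) ≤ A + L)
    (hdvd : ∀ u ∈ U, ((v ^ 2 : ℕ) : ℤ) ∣ 4 * N - u ^ 2) :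
    (U.card : ℝ) ≤ ((v ^ 2).divisors.card : ℝ) * (16 * L / (v ^ 2 : ℕ) + 1) := by
  rcases U.eq_empty_or_nonempty with rfl | ⟨u₀, hu₀⟩
  · simp only [Finset.card_empty, Nat.cast_zero]; positivity
  set w := v ^ 2
  have hw : 0 < w := by positivity
  have hwN : IsCoprime (w : ℤ) (N : ℤ) := Nat.isCoprime_iff_coprime.mpr (hcop.pow_left 2)
  have hmaps : ∀ u ∈ U, Int.gcd w (u - u₀) ∈ w.divisors := by
    intro u _
    rw [Nat.mem_divisors]
    refine ⟨?_, hw.ne'⟩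
    exact_mod_cast Int.gcd_dvd_left (w : ℤ) (u - u₀)
  have hfib : ∀ e ∈ w.divisors,
      ((U.filter fun u => Int.gcd w (u - u₀) = e).card : ℝ) ≤ 16 * L / w + 1 := by
    intro e he
    refine card_le_of_dvd_mul_sub hw hL 16 _ (fun u hu => hU u (Finset.mem_filter.mp hu).1)
      ?_ (by norm_num)
    obtain ⟨f, hf⟩ := (Nat.mem_divisors.mp he).1
    have he0 : (e : ℤ) ≠ 0 := by
      have := (Nat.mem_divisors.mp he).2
      rw [hf] at this
      exact_mod_cast left_ne_zero_of_mul this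
    have hwef : (w : ℤ) = e * f := by exact_mod_cast hf
    have key : ∀ u ∈ U, Int.gcd w (u - u₀) = e → (e : ℤ) ∣ u - u₀ ∧ (f : ℤ) ∣ u + u₀ := by
      intro u hu hue
      refine ⟨hue ▸ Int.gcd_dvd_right (w : ℤ) (u - u₀), ?_⟩
      have h1 : (w : ℤ) ∣ (u - u₀) * (u + u₀) := by
        have := dvd_sub (hdvd u₀ hu₀) (hdvd u hu)
        rwa [show 4 * (N : ℤ) - u₀ ^ 2 - (4 * N - u ^ 2) = (u - u₀) * (u + u₀) by ring] at this
      have h2 : (w : ℤ) ∣ Int.gcd w (u - u₀) * (u + u₀) := by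
        have := dvd_gcd_mul_of_dvd_mul h1
        rwa [← Int.coe_gcd] at this
      rw [hue, hwef] at h2
      exact (mul_dvd_mul_iff_left he0).mp h2
    intro u hu u' hu'
    obtain ⟨hu, hue⟩ := Finset.mem_filter.mp hu
    obtain ⟨hu', hue'⟩ := Finset.mem_filter.mp hu'
    obtain ⟨h1, h2⟩ := key u hu hue
    obtain ⟨h1', h2'⟩ := key u' hu' hue'
    have he' : (e : ℤ) ∣ u - u' := by simpa using dvd_sub h1 h1'
    have hf' : (f : ℤ) ∣ u - u' := by simpa using dvd_sub h2 h2'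
    have hlcm : (Int.lcm e f : ℤ) ∣ u - u' := Int.coe_lcm_dvd he' hf'
    have hg1 : (Int.gcd e f : ℤ) ∣ 2 * u₀ := by
      have := dvd_sub ((Int.gcd_dvd_right (e : ℤ) f).trans h2)
        ((Int.gcd_dvd_left (e : ℤ) f).trans h1)
      rwa [show u + u₀ - (u - u₀) = 2 * u₀ by ring] at this
    have hgw : (Int.gcd e f : ℤ) ∣ w := (Int.gcd_dvd_left (e : ℤ) f).trans ⟨f, hwef⟩
    have hg16 : (Int.gcd e f : ℤ) ∣ 16 := by
      have h3 : (Int.gcd e f : ℤ) ∣ 16 * N := by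
        have h4 := (hgw.trans (hdvd u₀ hu₀)).mul_left 4
        have h5 := hg1.mul_right (2 * u₀)
        have h6 := dvd_add h4 h5
        rwa [show 4 * (4 * (N : ℤ) - u₀ ^ 2) + 2 * u₀ * (2 * u₀) = 16 * N by ring] at h6
      exact (hwN.of_isCoprime_of_dvd_left hgw).dvd_of_dvd_mul_right h3
    have h6 : (Int.gcd e f : ℤ) * Int.lcm e f = w := by
      rw [hwef]
      have := Int.gcd_mul_lcm (e : ℤ) f
      rw [Int.natAbs_natCast, Int.natAbs_natCast] at this
      exact_mod_cast this
    rw [← h6]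
    exact mul_dvd_mul hg16 hlcm
  calc (U.card : ℝ) = ∑ e ∈ w.divisors, ((U.filter fun u => Int.gcd w (u - u₀) = e).card : ℝ) := by
        exact_mod_cast Finset.card_eq_sum_card_fiberwise hmaps
    _ ≤ ∑ e ∈ w.divisors, (16 * L / w + 1) := Finset.sum_le_sum hfib
    _ = _ := by rw [Finset.sum_const, nsmul_eq_mul]

lemma IsRepresented.exists_coprime {d n : ℕ} (hn : Odd n) (h : IsRepresented d n) :
    ∃ N, N ∣ n ∧ ∃ u v : ℕ, 0 < v ∧ v.Coprime N ∧ u ^ 2 + d * v ^ 2 = 4 * N := by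
  induction n using Nat.strong_induction_on with
  | _ n ih =>
    obtain ⟨u, v, hv, huv⟩ := h
    by_cases hc : v.natAbs.Coprime n
    · refine ⟨n, dvd_rfl, u.natAbs, v.natAbs, Int.natAbs_pos.mpr hv, hc, ?_⟩
      zify
      rw [sq_abs, sq_abs]
      exact huv
    · obtain ⟨r, hr, hrv, hrn⟩ := Nat.Prime.not_coprime_iff_dvd.mp hc
      have hrv' : (r : ℤ) ∣ v := Int.natCast_dvd.mpr hrv
      have hrn' : (r : ℤ) ∣ n := Int.natCast_dvd_natCast.mpr hrn
      have hrz : Prime (r : ℤ) := Nat.prime_iff_prime_int.mp hr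
      have hru : (r : ℤ) ∣ u := by
        refine hrz.dvd_of_dvd_pow (n := 2) ?_
        have h1 := dvd_sub (hrn'.mul_left 4) ((hrv'.pow two_ne_zero).mul_left (d : ℤ))
        rwa [← huv, add_sub_cancel_right] at h1
      obtain ⟨u, rfl⟩ := hru
      obtain ⟨v, rfl⟩ := hrv'
      have hr2 : Odd r := hn.of_dvd_nat hrn
      have hcop : IsCoprime ((r : ℤ) ^ 2) 4 := by
        have : Nat.Coprime (r ^ 2) 4 := by
          rw [show 4 = 2 ^ 2 by norm_num]
          exact Nat.Coprime.pow _ _ (Nat.coprime_two_right.mpr hr2)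
        exact_mod_cast Nat.isCoprime_iff_coprime.mpr this
      have hrn2 : (r : ℤ) ^ 2 ∣ n :=
        hcop.dvd_of_dvd_mul_left ⟨u ^ 2 + d * v ^ 2, by rw [← huv]; ring⟩
      have hrn3 : r ^ 2 ∣ n := by exact_mod_cast hrn2
      obtain ⟨n', rfl⟩ := hrn3
      have hr0 : (r : ℤ) ^ 2 ≠ 0 := pow_ne_zero _ hrz.ne_zero
      have hn' : Odd n' := (Nat.odd_mul.mp hn).2
      have hlt : n' < r ^ 2 * n' :=
        lt_mul_of_one_lt_left hn'.pos (one_lt_pow₀ hr.one_lt two_ne_zero)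
      obtain ⟨N, hN, rest⟩ := ih n' hlt hn' ⟨u, v, right_ne_zero_of_mul hv, by
        refine mul_left_cancel₀ hr0 ?_
        push_cast at huv
        linear_combination huv⟩
      exact ⟨N, hN.mul_left _, rest⟩

open Classical in
lemma card_coprime_represented_le {N Y : ℕ} (hN : 0 < N) (hY : 0 < Y) {T : ℝ}
    (hT : ∀ m : ℕ, 0 < m → m ≤ 4 * N → (m.divisors.card : ℝ) ≤ T) :
    (((Finset.Ico Y (2 * Y)).filter fun d => ∃ u v : ℕ, 0 < v ∧ v.Coprime N ∧
      u ^ 2 + d * v ^ 2 = 4 * N).card : ℝ) ≤ T * (32 * √Y + 2 * √N / √Y) := by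
  set D := (Finset.Ico Y (2 * Y)).filter fun d => ∃ u v : ℕ, 0 < v ∧ v.Coprime N ∧
      u ^ 2 + d * v ^ 2 = 4 * N
  have hD : ∀ d : ℕ, ∃ x : ℕ × ℕ, d ∈ D → 0 < x.2 ∧ x.2.Coprime N ∧
      x.1 ^ 2 + d * x.2 ^ 2 = 4 * N := by
    intro d
    by_cases hd : d ∈ D
    · obtain ⟨u, v, h⟩ := (Finset.mem_filter.mp hd).2
      exact ⟨(u, v), fun _ => h⟩
    · exact ⟨0, fun h => absurd h hd⟩
  choose x hx using hD
  have hN' : (0 : ℝ) < N := by exact_mod_cast hN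
  have hY' : (0 : ℝ) < Y := by exact_mod_cast hY
  have hsN : 0 < √(N : ℝ) := Real.sqrt_pos.mpr hN'
  have hsY : 0 < √(Y : ℝ) := Real.sqrt_pos.mpr hY'
  have hNN : √(N : ℝ) * √N = N := Real.mul_self_sqrt hN'.le
  have hYY : √(Y : ℝ) * √Y = Y := Real.mul_self_sqrt hY'.le
  have hT0 : 0 ≤ T := (Nat.cast_nonneg _).trans (hT 1 one_pos (by omega))
  set V := ⌊2 * √(N : ℝ) / √Y⌋₊
  have hVle : (V : ℝ) ≤ 2 * √N / √Y := Nat.floor_le (by positivity)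
  set L : ℕ → ℝ := fun v => Y * v ^ 2 / √N
  set U : ℕ → Finset ℤ := fun v => (Finset.Icc (0 : ℤ) (2 * N)).filter fun u =>
    (2 * √N - L v ≤ (u : ℝ) ∧ (u : ℝ) ≤ 2 * √N - L v + L v) ∧ ((v ^ 2 : ℕ) : ℤ) ∣ 4 * N - u ^ 2
  have hUcard : ∀ v ∈ (Finset.Icc 1 V).filter fun v => v.Coprime N,
      ((U v).card : ℝ) ≤ T * (16 * Y / √N + 1) := by
    intro v hv
    obtain ⟨hv, hcop⟩ := Finset.mem_filter.mp hv
    obtain ⟨hv1, hvV⟩ := Finset.mem_Icc.mp hv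
    have hv' : (0 : ℝ) < v := by exact_mod_cast hv1
    have h1 := card_sqrt_mod_le (A := 2 * √N - L v) (L := L v) hv1 hcop (by positivity) (U v)
      (fun u hu => (Finset.mem_filter.mp hu).2.1) (fun u hu => (Finset.mem_filter.mp hu).2.2)
    refine h1.trans ?_
    have h2 : 16 * L v / (v ^ 2 : ℕ) + 1 = 16 * Y / √N + 1 := by
      simp only [L]; push_cast; field_simp
    rw [h2]
    gcongr
    refine hT _ (by positivity) ?_
    have h3 : (v : ℝ) ≤ 2 * √N / √Y := le_trans (by exact_mod_cast hvV) hVle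
    have h4 : (1 : ℝ) ≤ √Y := Real.one_le_sqrt.mpr (by exact_mod_cast hY)
    have h5 : (v : ℝ) ≤ 2 * √N := h3.trans (div_le_self (by positivity) h4)
    have h6 : ((v ^ 2 : ℕ) : ℝ) ≤ (4 * N : ℕ) := by
      push_cast
      calc (v : ℝ) ^ 2 ≤ (2 * √(N : ℝ)) ^ 2 := by gcongr
        _ = 4 * (N : ℝ) := by rw [mul_pow, sq √(N : ℝ), hNN]; norm_num
    exact_mod_cast h6
  have hcard : D.card ≤ (((Finset.Icc 1 V).filter fun v => v.Coprime N).sigma U).card := by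
    refine Finset.card_le_card_of_injOn (fun d => ⟨(x d).2, ((x d).1 : ℤ)⟩) ?_ ?_
    · intro d hd
      have hdY := Finset.mem_Ico.mp (Finset.mem_filter.mp hd).1
      obtain ⟨hv, hcop, h⟩ := hx d hd
      set u := (x d).1
      set v := (x d).2
      have hR : (u : ℝ) ^ 2 + d * (v : ℝ) ^ 2 = 4 * N := by exact_mod_cast h
      have hv' : (0 : ℝ) < v := by exact_mod_cast hv
      have hu0 : (0 : ℝ) ≤ u := Nat.cast_nonneg u
      have hdY1 : (Y : ℝ) ≤ d := by exact_mod_cast hdY.1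
      have hdY2 : (d : ℝ) ≤ 2 * Y := by exact_mod_cast hdY.2.le
      have hdv : (Y : ℝ) * v ^ 2 ≤ d * v ^ 2 := by gcongr
      have hdv2 : (d : ℝ) * v ^ 2 ≤ 2 * Y * v ^ 2 := by gcongr
      have hu2 : (u : ℝ) ≤ 2 * √N := by
        refine abs_le_of_sq_le_sq' ?_ (by positivity) |>.2
        rw [mul_pow, sq √(N : ℝ), hNN]
        have : 0 ≤ (Y : ℝ) * v ^ 2 := by positivity
        nlinarith
      rw [Finset.mem_coe, Finset.mem_sigma, Finset.mem_filter, Finset.mem_Icc, Finset.mem_filter,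
        Finset.mem_Icc]
      refine ⟨⟨⟨hv, ?_⟩, hcop⟩, ⟨⟨by positivity, ?_⟩, ⟨?_, ?_⟩, ?_⟩⟩
      · refine Nat.le_floor ?_
        rw [le_div_iff₀ hsY]
        refine abs_le_of_sq_le_sq' ?_ (by positivity) |>.2
        rw [mul_pow, mul_pow, sq √(N : ℝ), hNN, sq √(Y : ℝ), hYY]
        nlinarith [sq_nonneg (u : ℝ)]
      · have hN1 : (1 : ℝ) ≤ N := by exact_mod_cast hN
        have : √(N : ℝ) ≤ N := by
          rw [Real.sqrt_le_left (by positivity)]; nlinarith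
        have : (u : ℝ) ≤ 2 * N := by linarith
        change (u : ℤ) ≤ 2 * (N : ℤ)
        exact_mod_cast this
      · change 2 * √(N : ℝ) - Y * v ^ 2 / √N ≤ ((u : ℤ) : ℝ)
        rw [Int.cast_natCast, sub_le_comm, le_div_iff₀ hsN]
        nlinarith
      · change ((u : ℤ) : ℝ) ≤ _
        rw [Int.cast_natCast]; linarith
      · refine ⟨d, ?_⟩
        have : (u : ℤ) ^ 2 + d * (v : ℤ) ^ 2 = 4 * N := by exact_mod_cast h
        push_cast
        linarith
    · intro d hd d' hd' hdd
      simp only [Sigma.mk.injEq, heq_eq_eq, Nat.cast_inj] at hdd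
      obtain ⟨hv, -, h⟩ := hx d hd
      obtain ⟨-, -, h'⟩ := hx d' hd'
      rw [← hdd.1, ← hdd.2] at h'
      have : d * (x d).2 ^ 2 = d' * (x d).2 ^ 2 := by omega
      exact Nat.eq_of_mul_eq_mul_right (by positivity) this
  rw [Finset.card_sigma] at hcard
  calc (D.card : ℝ) ≤ ∑ v ∈ (Finset.Icc 1 V).filter fun v => v.Coprime N, ((U v).card : ℝ) := by
        exact_mod_cast hcard
    _ ≤ ∑ v ∈ (Finset.Icc 1 V).filter fun v => v.Coprime N, T * (16 * Y / √N + 1) :=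
        Finset.sum_le_sum hUcard
    _ = ((Finset.Icc 1 V).filter fun v => v.Coprime N).card * (T * (16 * Y / √N + 1)) := by
        rw [Finset.sum_const, nsmul_eq_mul]
    _ ≤ V * (T * (16 * Y / √N + 1)) := by
        gcongr
        exact (Finset.card_filter_le _ _).trans (by simp)
    _ ≤ 2 * √N / √Y * (T * (16 * Y / √N + 1)) := by gcongr
    _ = T * (32 * (√Y * √Y) / √Y + 2 * √N / √Y) := by rw [hYY]; field_simp; ring
    _ = T * (32 * √Y + 2 * √N / √Y) := by field_simp

open Classical in
theorem card_represented_le {n Y : ℕ} (hn : Odd n) (hY : 0 < Y) {T : ℝ}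
    (hT : ∀ m : ℕ, 0 < m → m ≤ 4 * n → (m.divisors.card : ℝ) ≤ T) :
    (((Finset.Ico Y (2 * Y)).filter fun d => IsRepresented d n).card : ℝ) ≤
      n.divisors.card * (T * (32 * √Y + 2 * √n / √Y)) := by
  have hT0 : 0 ≤ T := (Nat.cast_nonneg _).trans (hT 1 one_pos (by have := hn.pos; omega))
  have hsub : ((Finset.Ico Y (2 * Y)).filter fun d => IsRepresented d n) ⊆
      n.divisors.biUnion fun N => (Finset.Ico Y (2 * Y)).filter fun d => ∃ u v : ℕ, 0 < v ∧
        v.Coprime N ∧ u ^ 2 + d * v ^ 2 = 4 * N := by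
    intro d hd
    obtain ⟨hd, hrep⟩ := Finset.mem_filter.mp hd
    obtain ⟨N, hN, rest⟩ := hrep.exists_coprime hn
    exact Finset.mem_biUnion.mpr
      ⟨N, Nat.mem_divisors.mpr ⟨hN, hn.pos.ne'⟩, Finset.mem_filter.mpr ⟨hd, rest⟩⟩
  have h1 := (Finset.card_le_card hsub).trans Finset.card_biUnion_le
  calc _ ≤ ∑ N ∈ n.divisors, (((Finset.Ico Y (2 * Y)).filter fun d => ∃ u v : ℕ, 0 < v ∧
        v.Coprime N ∧ u ^ 2 + d * v ^ 2 = 4 * N).card : ℝ) := by exact_mod_cast h1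
    _ ≤ ∑ N ∈ n.divisors, T * (32 * √Y + 2 * √n / √Y) := by
        refine Finset.sum_le_sum fun N hN => ?_
        have hNn : N ≤ n := Nat.divisor_le hN
        refine (card_coprime_represented_le (Nat.pos_of_mem_divisors hN) hY
          fun m hm hmN => hT m hm (by omega)).trans ?_
        gcongr
    _ = _ := by rw [Finset.sum_const, nsmul_eq_mul]

lemma abs_sum_range_le_of_periodic {m : ℕ} {F : ℕ → ℤ} (hper : ∀ a, F (m + a) = F a)
    (habs : ∀ a, |F a| ≤ 1) (hsum : ∑ a ∈ Finset.range m, F a = 0) (hm : 0 < m) (D : ℕ) :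
    |∑ a ∈ Finset.range D, F a| ≤ m := by
  induction D using Nat.strong_induction_on with
  | _ D ih =>
    rcases lt_or_ge D m with h | h
    · calc |∑ a ∈ Finset.range D, F a| ≤ ∑ a ∈ Finset.range D, |F a| :=
            Finset.abs_sum_le_sum_abs _ _
        _ ≤ ∑ a ∈ Finset.range D, 1 := Finset.sum_le_sum fun a _ => habs a
        _ ≤ m := by simpa using h.le
    · obtain ⟨E, rfl⟩ := Nat.exists_eq_add_of_le h
      rw [Finset.sum_range_add, hsum, zero_add]
      simp only [hper]
      exact ih E (by omega)

lemma sum_range_natCast_zmod {m : ℕ} [NeZero m] (f : ZMod m → ℤ) :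
    ∑ a ∈ Finset.range m, f a = ∑ x, f x := by
  refine Finset.sum_bij' (fun a _ => (a : ZMod m)) (fun x _ => x.val) ?_ ?_ ?_ ?_ ?_
  · simp
  · intro x _; simpa using x.val_lt
  · intro a ha; exact ZMod.val_cast_of_lt (Finset.mem_range.mp ha)
  · intro x _; exact ZMod.natCast_zmod_val x
  · simp

lemma sum_range_mul_of_coprime {p q : ℕ} [NeZero p] [NeZero q] (hpq : p.Coprime q)
    (f : ZMod p → ℤ) (h : ZMod q → ℤ) :
    ∑ a ∈ Finset.range (p * q), f a * h a = (∑ x, f x) * ∑ y, h y := by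
  set e := ZMod.chineseRemainder hpq
  have h1 := sum_range_natCast_zmod (m := p * q) fun x => f (e x).1 * h (e x).2
  simp only [map_natCast, Prod.fst_natCast, Prod.snd_natCast] at h1
  rw [h1, Finset.sum_mul_sum, ← Finset.sum_product', Finset.univ_product_univ]
  exact e.toEquiv.sum_comp fun z : ZMod p × ZMod q => f z.1 * h z.2

lemma sum_jacobiSym_neg_mul_jacobiSym_neg {p q : ℕ} (hp : p.Prime) (hp2 : p ≠ 2) (hq : q.Prime)
    (hpq : p ≠ q) :
    ∑ a ∈ Finset.range (p * q), jacobiSym (-a) p * jacobiSym (-a) q = 0 := by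
  have : Fact p.Prime := ⟨hp⟩
  have : Fact q.Prime := ⟨hq⟩
  have h1 := sum_range_mul_of_coprime ((Nat.coprime_primes hp hq).mpr hpq)
    (fun x => quadraticChar (ZMod p) (-x)) (fun x => quadraticChar (ZMod q) (-x))
  have h2 : ∑ x : ZMod p, quadraticChar (ZMod p) (-x) = 0 := by
    refine (Equiv.sum_comp (Equiv.neg (ZMod p)) fun x => quadraticChar (ZMod p) x).trans ?_
    exact quadraticChar_sum_zero (by rwa [ZMod.ringChar_zmod_n])
  rw [h2, zero_mul] at h1
  rw [← h1]
  refine Finset.sum_congr rfl fun a _ => ?_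
  rw [← jacobiSym.legendreSym.to_jacobiSym, ← jacobiSym.legendreSym.to_jacobiSym, legendreSym,
    legendreSym]
  push_cast
  rfl

lemma abs_jacobiSym_le_one (a : ℤ) (b : ℕ) : |jacobiSym a b| ≤ 1 := by
  rcases jacobiSym.trichotomy a b with h | h | h <;> simp [h]

lemma jacobiSym_neg_add_mul (a p q : ℕ) :
    jacobiSym (-((p * q + a : ℕ) : ℤ)) p = jacobiSym (-a) p := by
  rw [jacobiSym.mod_left (-((p * q + a : ℕ) : ℤ)), jacobiSym.mod_left (-a)]
  congr 1
  refine Int.ModEq.symm ((Int.modEq_iff_dvd).mpr ⟨-q, ?_⟩)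
  push_cast
  ring

/-- A second moment bound for sums of quadratic characters to distinct prime moduli. -/
lemma sum_sq_sum_jacobiSym_le {P : Finset ℕ} {n : ℕ}
    (hP : ∀ p ∈ P, p.Prime ∧ p ≠ 2 ∧ p ≤ n) (D : ℕ) :
    ∑ d ∈ Finset.range D, (∑ p ∈ P, jacobiSym (-d) p) ^ 2 ≤
      (P.card * D + P.card ^ 2 * n ^ 2 : ℤ) := by
  have hterm : ∀ p ∈ P, ∀ q ∈ P, ∑ d ∈ Finset.range D, jacobiSym (-d) p * jacobiSym (-d) q ≤
      (if p = q then (D : ℤ) else 0) + n ^ 2 := by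
    intro p hp q hq
    have habs : ∀ d : ℕ, |jacobiSym (-d) p * jacobiSym (-d) q| ≤ 1 := fun d => by
      rw [abs_mul]
      exact mul_le_one₀ (abs_jacobiSym_le_one _ _) (abs_nonneg _) (abs_jacobiSym_le_one _ _)
    split_ifs with hpq
    · calc _ ≤ ∑ d ∈ Finset.range D, (1 : ℤ) :=
            Finset.sum_le_sum fun d _ => (le_abs_self _).trans (habs d)
        _ ≤ _ := by simp
    · obtain ⟨hpp, hp2, hpn⟩ := hP p hp
      obtain ⟨hqp, -, hqn⟩ := hP q hq
      have h1 := abs_sum_range_le_of_periodic (m := p * q)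
        (F := fun d => jacobiSym (-d) p * jacobiSym (-d) q) (fun a => by
          rw [jacobiSym_neg_add_mul, mul_comm p q, jacobiSym_neg_add_mul]) habs
        (sum_jacobiSym_neg_mul_jacobiSym_neg hpp hp2 hqp hpq) (Nat.mul_pos hpp.pos hqp.pos) D
      have h2 : ((p * q : ℕ) : ℤ) ≤ n ^ 2 := by
        rw [sq]; exact_mod_cast Nat.mul_le_mul hpn hqn
      linarith [le_abs_self (∑ d ∈ Finset.range D, jacobiSym (-d) p * jacobiSym (-d) q)]
  calc ∑ d ∈ Finset.range D, (∑ p ∈ P, jacobiSym (-d) p) ^ 2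
      = ∑ p ∈ P, ∑ q ∈ P, ∑ d ∈ Finset.range D, jacobiSym (-d) p * jacobiSym (-d) q := by
        simp only [sq, Finset.sum_mul_sum]
        rw [Finset.sum_comm]
        exact Finset.sum_congr rfl fun p _ => Finset.sum_comm
    _ ≤ ∑ p ∈ P, ∑ q ∈ P, ((if p = q then (D : ℤ) else 0) + n ^ 2) :=
        Finset.sum_le_sum fun p hp => Finset.sum_le_sum fun q hq => hterm p hp q hq
    _ = _ := by
        simp only [Finset.sum_add_distrib, Finset.sum_const, nsmul_eq_mul]
        rw [Finset.sum_congr rfl fun p hp => by rw [Finset.sum_ite_eq, if_pos hp]]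
        simp only [Finset.sum_const, nsmul_eq_mul]
        ring

lemma jacobiSym_neg_eq_neg_one {p d : ℕ} (hp : p.Prime) (h : ¬ ∃ b : ℤ, (p : ℤ) ∣ b ^ 2 + d) :
    jacobiSym (-d) p = -1 := by
  have : Fact p.Prime := ⟨hp⟩
  rw [← jacobiSym.legendreSym.to_jacobiSym, legendreSym.eq_neg_one_iff]
  rintro ⟨b, hb⟩
  refine h ⟨b.val, (ZMod.intCast_zmod_eq_zero_iff_dvd _ p).mp ?_⟩
  push_cast at hb ⊢
  rw [ZMod.natCast_zmod_val, sq, ← hb, neg_add_cancel]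

open Classical in
/-- Few `d` are such that `-d` is a square modulo less than a quarter of the primes of `P`. -/
theorem card_few_splitting_primes_le {P : Finset ℕ} {n : ℕ}
    (hP : ∀ p ∈ P, p.Prime ∧ p ≠ 2 ∧ p ≤ n) (D : ℕ) :
    ((Finset.range D).filter fun d : ℕ =>
      4 * (P.filter fun p : ℕ => ∃ b : ℤ, (p : ℤ) ∣ b ^ 2 + d).card < P.card).card * P.card ≤
    4 * (D + P.card * n ^ 2) := by
  rcases P.eq_empty_or_nonempty with rfl | hne
  · simp
  set B := (Finset.range D).filter fun d : ℕ =>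
    4 * (P.filter fun p : ℕ => ∃ b : ℤ, (p : ℤ) ∣ b ^ 2 + d).card < P.card
  have hB : ∀ d ∈ B, (P.card ^ 2 : ℤ) ≤ 4 * (∑ p ∈ P, jacobiSym (-d) p) ^ 2 := by
    intro d hd
    have hd := (Finset.mem_filter.mp hd).2
    set M := (P.filter fun p : ℕ => ∃ b : ℤ, (p : ℤ) ∣ b ^ 2 + d).card with hM
    have h1 : ∑ p ∈ P, jacobiSym (-d) p ≤ 2 * M - P.card := by
      calc ∑ p ∈ P, jacobiSym (-d) p
          ≤ ∑ p ∈ P, (2 * (if ∃ b : ℤ, (p : ℤ) ∣ b ^ 2 + d then 1 else 0) - 1) := by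
            refine Finset.sum_le_sum fun p hp => ?_
            split_ifs with h
            · exact (le_abs_self _).trans ((abs_jacobiSym_le_one _ _).trans (by norm_num))
            · rw [jacobiSym_neg_eq_neg_one (hP p hp).1 h]; norm_num
        _ = _ := by
            rw [Finset.sum_sub_distrib, ← Finset.mul_sum, Finset.sum_boole, ← hM]
            simp
    have h2 : 4 * (M : ℤ) < P.card := by exact_mod_cast hd
    nlinarith
  have h3 : (B.card * P.card ^ 2 : ℤ) ≤ 4 * (P.card * D + P.card ^ 2 * n ^ 2) := by
    calc (B.card * P.card ^ 2 : ℤ) = ∑ d ∈ B, (P.card ^ 2 : ℤ) := by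
          rw [Finset.sum_const, nsmul_eq_mul]
      _ ≤ ∑ d ∈ B, 4 * (∑ p ∈ P, jacobiSym (-d) p) ^ 2 := Finset.sum_le_sum hB
      _ ≤ ∑ d ∈ Finset.range D, 4 * (∑ p ∈ P, jacobiSym (-d) p) ^ 2 :=
          Finset.sum_le_sum_of_subset_of_nonneg (Finset.filter_subset _ _)
            fun _ _ _ => by positivity
      _ ≤ _ := by
          rw [← Finset.mul_sum]
          exact mul_le_mul_of_nonneg_left (sum_sq_sum_jacobiSym_le hP D) (by norm_num)
  have h4 : B.card * P.card * P.card ≤ 4 * (D + P.card * n ^ 2) * P.card := by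
    zify
    nlinarith
  exact Nat.le_of_mul_le_mul_right h4 hne.card_pos

/-- The divisor bound. -/
theorem exists_card_divisors_le_mul_rpow {δ : ℝ} (hδ : 0 < δ) :
    ∃ C : ℝ, 1 ≤ C ∧ ∀ n : ℕ, 0 < n → (n.divisors.card : ℝ) ≤ C * (n : ℝ) ^ δ := by
  obtain ⟨N, hN⟩ := exists_nat_gt ((2 : ℝ) ^ (1 / δ))
  set K : ℝ := 1 + 1 / (δ * Real.log 2)
  have hlog : 0 < Real.log 2 := Real.log_pos one_lt_two
  have hK : 1 ≤ K := by
    have : 0 < 1 / (δ * Real.log 2) := by positivity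
    simp only [K]; linarith
  have hlarge : ∀ p k : ℕ, N ≤ p → ((k + 1 : ℕ) : ℝ) ≤ (p : ℝ) ^ (δ * k) := by
    intro p k hp
    have hp' : (2 : ℝ) ^ (1 / δ) ≤ p := hN.le.trans (by exact_mod_cast hp)
    have h1 : (2 : ℝ) ≤ (p : ℝ) ^ δ := by
      calc (2 : ℝ) = ((2 : ℝ) ^ (1 / δ)) ^ δ := by
            rw [← Real.rpow_mul zero_le_two, one_div_mul_cancel hδ.ne', Real.rpow_one]
        _ ≤ _ := Real.rpow_le_rpow (by positivity) hp' hδ.le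
    rw [Real.rpow_mul (Nat.cast_nonneg p), Real.rpow_natCast]
    calc ((k + 1 : ℕ) : ℝ) ≤ ((2 ^ k : ℕ) : ℝ) := by exact_mod_cast Nat.lt_two_pow_self
      _ = (2 : ℝ) ^ k := by push_cast; rfl
      _ ≤ _ := by gcongr
  have hsmall : ∀ p k : ℕ, 2 ≤ p → ((k + 1 : ℕ) : ℝ) ≤ K * (p : ℝ) ^ (δ * k) := by
    intro p k hp
    have hp' : (2 : ℝ) ≤ p := by exact_mod_cast hp
    have h1 : 1 + δ * k * Real.log 2 ≤ (p : ℝ) ^ (δ * k) := by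
      calc 1 + δ * k * Real.log 2 ≤ Real.exp (δ * k * Real.log 2) := by
            linarith [Real.add_one_le_exp (δ * k * Real.log 2)]
        _ = (2 : ℝ) ^ (δ * k) := by rw [Real.rpow_def_of_pos zero_lt_two, mul_comm]
        _ ≤ _ := Real.rpow_le_rpow zero_le_two hp' (by positivity)
    calc ((k + 1 : ℕ) : ℝ) ≤ K * (1 + δ * k * Real.log 2) := by
          have h2 : K * (δ * k * Real.log 2) = δ * k * Real.log 2 + k := by
            simp only [K]; field_simp
          have : 0 ≤ δ * k * Real.log 2 := by positivity
          push_cast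
          linarith
      _ ≤ _ := by gcongr
  refine ⟨K ^ N, one_le_pow₀ hK, fun n hn => ?_⟩
  have hprod : (n : ℝ) ^ δ = ∏ p ∈ n.primeFactors, (p : ℝ) ^ (δ * n.factorization p) := by
    conv_lhs => rw [← Nat.prod_factorization_pow_eq_self hn.ne',
      Nat.prod_factorization_eq_prod_primeFactors]
    push_cast
    rw [← Real.finsetProd_rpow _ _ fun p _ => by positivity]
    refine Finset.prod_congr rfl fun p _ => ?_
    rw [mul_comm, Real.rpow_mul (Nat.cast_nonneg p), Real.rpow_natCast]
  rw [Nat.card_divisors hn.ne', hprod]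
  push_cast
  calc ∏ p ∈ n.primeFactors, ((n.factorization p : ℝ) + 1)
      ≤ ∏ p ∈ n.primeFactors, ((if p < N then K else 1) * (p : ℝ) ^ (δ * n.factorization p)) := by
        refine Finset.prod_le_prod (fun _ _ => by positivity) fun p hp => ?_
        split_ifs with h
        · exact_mod_cast hsmall p _ (Nat.prime_of_mem_primeFactors hp).two_le
        · rw [one_mul]; exact_mod_cast hlarge p _ (not_lt.mp h)
    _ = (∏ p ∈ n.primeFactors, if p < N then K else 1) *
          ∏ p ∈ n.primeFactors, (p : ℝ) ^ (δ * n.factorization p) := Finset.prod_mul_distrib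
    _ ≤ _ := by
        gcongr
        rw [← Finset.prod_filter, Finset.prod_const]
        refine pow_le_pow_right₀ hK ?_
        calc _ ≤ (Finset.range N).card := Finset.card_le_card fun p hp =>
              Finset.mem_range.mpr (Finset.mem_filter.mp hp).2
          _ = N := Finset.card_range N

/-- A weak lower bound of Chebyshev type for the number of odd primes. -/
theorem exists_mul_rpow_le_card_odd_primes {δ : ℝ} (hδ : 0 < δ) :
    ∃ c : ℝ, 0 < c ∧ ∀ n : ℕ, 3 ≤ n → c * (n : ℝ) ^ (1 - δ) ≤
      (((Finset.Icc 1 n).filter fun p => p.Prime ∧ p ≠ 2).card : ℝ) := by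
  have hcard : ∀ n : ℕ, 3 ≤ n →
      ((Finset.Icc 1 n).filter fun p => p.Prime ∧ p ≠ 2).card + 1 = Nat.primeCounting n := by
    intro n hn
    rw [Nat.primeCounting, Nat.primeCounting', Nat.count_eq_card_filter_range,
      ← Finset.card_insert_of_notMem (a := 2) (by simp)]
    congr 1
    ext p
    simp only [Finset.mem_insert, Finset.mem_filter, Finset.mem_Icc, Finset.mem_range]
    constructor
    · rintro (rfl | h)
      · exact ⟨by omega, Nat.prime_two⟩
      · exact ⟨by omega, h.2.1⟩
    · rintro ⟨h1, h2⟩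
      have := h2.pos
      by_cases h : p = 2
      · exact Or.inl h
      · exact Or.inr ⟨by omega, h2, h⟩
  have hev : ∀ᶠ x : ℝ in Filter.atTop, Real.log x ≤ 1 / 10 * x := by
    filter_upwards [Real.isLittleO_log_id_atTop.def (by norm_num : (0 : ℝ) < 1 / 10),
      Filter.eventually_ge_atTop 0] with x hx hx0
    rw [id, Real.norm_of_nonneg hx0] at hx
    exact (le_abs_self _).trans hx
  obtain ⟨A, hA⟩ := Filter.eventually_atTop.mp hev
  obtain ⟨N, hN⟩ := exists_nat_gt A
  refine ⟨min (δ / 4) (1 / (N + 1)), by positivity, fun n hn => ?_⟩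
  have hn3 : (3 : ℝ) ≤ n := by exact_mod_cast hn
  have hn0 : (0 : ℝ) < n := by linarith
  rcases le_or_gt N n with hNn | hNn
  · have hlog : 0 < Real.log n := Real.log_pos (by linarith)
    have h1 : Real.log n ≤ 1 / 10 * n := hA n (hN.le.trans (by exact_mod_cast hNn))
    have h2 : Real.log (n + 1) ≤ 2 * Real.log n := by
      rw [← Real.log_rpow hn0]
      refine Real.log_le_log (by positivity) ?_
      rw [Real.rpow_two]
      nlinarith
    have h3 := Chebyshev.pi_ge n
    rw [div_le_iff₀ hlog, ← hcard n hn] at h3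
    push_cast at h3
    have h4 := Real.log_two_gt_d9
    have h5 : (n : ℝ) / 4 ≤ (((Finset.Icc 1 n).filter fun p => p.Prime ∧ p ≠ 2).card : ℝ) *
        Real.log n := by
      have : 0.69 * (n : ℝ) ≤ n * Real.log 2 := by nlinarith
      linarith
    have h6 : Real.log n ≤ (n : ℝ) ^ δ / δ := Real.log_le_rpow_div hn0.le hδ
    have h7 : (n : ℝ) / 4 ≤ (((Finset.Icc 1 n).filter fun p => p.Prime ∧ p ≠ 2).card : ℝ) *
        ((n : ℝ) ^ δ / δ) := h5.trans (by gcongr)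
    calc min (δ / 4) (1 / (N + 1 : ℝ)) * (n : ℝ) ^ (1 - δ) ≤ δ / 4 * (n : ℝ) ^ (1 - δ) := by
          gcongr; exact min_le_left _ _
      _ = n / 4 / ((n : ℝ) ^ δ / δ) := by
          rw [Real.rpow_sub hn0, Real.rpow_one]; field_simp
      _ ≤ _ := by rw [div_le_iff₀ (by positivity)]; exact h7
  · have h1 : 1 ≤ ((Finset.Icc 1 n).filter fun p => p.Prime ∧ p ≠ 2).card :=
      Finset.card_pos.mpr ⟨3, by simpa [hn] using Nat.prime_three⟩
    have h2 : (n : ℝ) ^ (1 - δ) ≤ N + 1 := by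
      calc (n : ℝ) ^ (1 - δ) ≤ (n : ℝ) ^ (1 : ℝ) :=
            Real.rpow_le_rpow_of_exponent_le (by linarith) (by linarith)
        _ = n := Real.rpow_one _
        _ ≤ N + 1 := by exact_mod_cast (by omega : n ≤ N + 1)
    calc min (δ / 4) (1 / (N + 1 : ℝ)) * (n : ℝ) ^ (1 - δ) ≤ 1 / (N + 1) * (N + 1) := by
          gcongr; exact min_le_right _ _
      _ = 1 := one_div_mul_cancel (by positivity)
      _ ≤ _ := by exact_mod_cast h1

open Classical in
/-- The bound on a dyadic block, in terms of an auxiliary set of odd primes. -/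
theorem sum_hneg_dyadic_le {g Y n : ℕ} (hg : Odd g) (hY : 0 < Y) {P : Finset ℕ}
    (hP : ∀ p ∈ P, p.Prime ∧ p ≠ 2 ∧ p ≤ n) (hne : P.Nonempty) {T : ℝ}
    (hT : ∀ m : ℕ, 0 < m → m ≤ 16 * Y + 4 * n ^ (2 * g) → (m.divisors.card : ℝ) ≤ T) :
    ∑ d ∈ (Finset.Ico Y (2 * Y)).filter Squarefree, (hneg g d : ℝ) ≤
      (2 * √(2 * Y) + 1) * T * (12 * Y / P.card + 4 * n ^ 2 +
        16 * (T * (T * (32 * √Y + 2 * n ^ g / √Y)))) := by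
  have hT0 : 0 ≤ T := (Nat.cast_nonneg _).trans (hT 1 one_pos (by omega))
  have hπ : (0 : ℝ) < P.card := by exact_mod_cast hne.card_pos
  have hY' : (0 : ℝ) < Y := by exact_mod_cast hY
  set H : ℝ := (2 * √(2 * Y) + 1) * T
  have hH : 0 ≤ H := by positivity
  set S : ℕ → Finset ℕ := fun d => P.filter fun p : ℕ => ∃ b : ℤ, (p : ℤ) ∣ b ^ 2 + d
  set R : ℕ → ℕ := fun d => (P.offDiag.filter fun x => IsRepresented d ((x.1 * x.2) ^ g)).card
  set I := Finset.Ico Y (2 * Y)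
  have hcl : ∀ d ∈ I, Squarefree d →
      (Nat.card (ClassGroup (NumberField.RingOfIntegers (Kneg d))) : ℝ) ≤ H := by
    intro d hd hsq
    obtain ⟨hd1, hd2⟩ := Finset.mem_Ico.mp hd
    have hd2' : (d : ℝ) ≤ 2 * Y := by exact_mod_cast hd2.le
    refine (card_classGroup_kneg_le (by omega) hsq fun m hm hmd => hT m hm ?_).trans ?_
    · have : 0 ≤ 4 * n ^ (2 * g) := by positivity
      omega
    · simp only [H]; gcongr
  have hpoint : ∀ d ∈ I.filter Squarefree, (hneg g d : ℝ) ≤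
      H * ((if 4 * (S d).card < P.card then 1 else 0) + (4 / P.card + 16 / P.card ^ 2 * R d)) := by
    intro d hd
    obtain ⟨hd, hsq⟩ := Finset.mem_filter.mp hd
    have hd0 : 0 < d := by have := (Finset.mem_Ico.mp hd).1; omega
    have hle : (hneg g d : ℝ) ≤ H :=
      le_trans (by exact_mod_cast hneg_le_card_classGroup hd0) (hcl d hd hsq)
    have hnn : 0 ≤ 4 / (P.card : ℝ) + 16 / P.card ^ 2 * R d := by positivity
    split_ifs with h
    · nlinarith
    · have h1 : (P.card : ℝ) / 4 ≤ (S d).card := by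
        rw [div_le_iff₀ (by norm_num)]
        exact_mod_cast (by omega : P.card ≤ (S d).card * 4)
      have hM : (0 : ℝ) < (S d).card := by linarith
      have h2 : (hneg g d : ℝ) * (S d).card ^ 2 ≤ H * ((S d).card + R d) := by
        have h3 := hneg_mul_card_sq_le hg hd0 hsq P (S d) (Finset.filter_subset _ _)
          fun p hp => ⟨(hP p (Finset.mem_filter.mp hp).1).1, (hP p (Finset.mem_filter.mp hp).1).2.1,
            (Finset.mem_filter.mp hp).2⟩
        have h4 : (hneg g d : ℝ) * (S d).card ^ 2 ≤
            Nat.card (ClassGroup (NumberField.RingOfIntegers (Kneg d))) * ((S d).card + R d) := by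
          exact_mod_cast h3
        exact h4.trans (by gcongr; exact hcl d hd hsq)
      rw [zero_add]
      calc (hneg g d : ℝ) ≤ H * ((S d).card + R d) / (S d).card ^ 2 := by
            rwa [le_div_iff₀ (by positivity)]
        _ = H * (1 / (S d).card + 1 / (S d).card ^ 2 * R d) := by field_simp
        _ ≤ H * (1 / (P.card / 4) + 1 / (P.card / 4) ^ 2 * R d) := by gcongr
        _ = _ := by field_simp; ring
  have hbad : ∑ d ∈ I, (if 4 * (S d).card < P.card then 1 else 0 : ℝ) ≤
      8 * Y / P.card + 4 * n ^ 2 := by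
    have h1 := card_few_splitting_primes_le hP (2 * Y)
    have h2 : ∑ d ∈ I, (if 4 * (S d).card < P.card then 1 else 0 : ℝ) ≤
        ((Finset.range (2 * Y)).filter fun d => 4 * (S d).card < P.card).card := by
      rw [Finset.sum_boole]
      gcongr
      intro d hd
      exact Finset.mem_range.mpr (Finset.mem_Ico.mp hd).2
    refine h2.trans ?_
    have h3 : (((Finset.range (2 * Y)).filter fun d => 4 * (S d).card < P.card).card : ℝ) *
        P.card ≤ 4 * (2 * Y + P.card * n ^ 2) := by exact_mod_cast h1
    rw [← le_div_iff₀ hπ] at h3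
    refine h3.trans (le_of_eq ?_)
    field_simp
    ring
  have hR : ∑ d ∈ I, (R d : ℝ) ≤ P.card ^ 2 * (T * (T * (32 * √Y + 2 * n ^ g / √Y))) := by
    have h1 : ∑ d ∈ I, R d =
        ∑ x ∈ P.offDiag, (I.filter fun d => IsRepresented d ((x.1 * x.2) ^ g)).card := by
      simp only [R, Finset.card_filter]
      exact Finset.sum_comm
    have h2 : ∀ x ∈ P.offDiag, ((I.filter fun d => IsRepresented d ((x.1 * x.2) ^ g)).card : ℝ) ≤
        T * (T * (32 * √Y + 2 * n ^ g / √Y)) := by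
      intro x hx
      obtain ⟨hp, hq, -⟩ := Finset.mem_offDiag.mp hx
      obtain ⟨hp, hp2, hpn⟩ := hP _ hp
      obtain ⟨hq, hq2, hqn⟩ := hP _ hq
      have hodd : Odd ((x.1 * x.2) ^ g) := ((hp.odd_of_ne_two hp2).mul (hq.odd_of_ne_two hq2)).pow
      have hlen : (x.1 * x.2) ^ g ≤ n ^ (2 * g) := by
        rw [pow_mul, sq]; gcongr
      have h3 := card_represented_le hodd hY fun m hm hmn => hT m hm (by omega)
      refine h3.trans ?_
      have h4 : (((x.1 * x.2) ^ g).divisors.card : ℝ) ≤ T := hT _ hodd.pos (by omega)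
      have h5 : √(((x.1 * x.2) ^ g : ℕ) : ℝ) ≤ (n : ℝ) ^ g := by
        rw [Real.sqrt_le_left (by positivity), ← pow_mul, mul_comm g]
        exact_mod_cast hlen
      gcongr
    calc ∑ d ∈ I, (R d : ℝ) = ∑ x ∈ P.offDiag,
          ((I.filter fun d => IsRepresented d ((x.1 * x.2) ^ g)).card : ℝ) := by exact_mod_cast h1
      _ ≤ ∑ x ∈ P.offDiag, T * (T * (32 * √Y + 2 * n ^ g / √Y)) := Finset.sum_le_sum h2
      _ = P.offDiag.card * (T * (T * (32 * √Y + 2 * n ^ g / √Y))) := by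
          rw [Finset.sum_const, nsmul_eq_mul]
      _ ≤ _ := by
          gcongr
          have : P.offDiag.card ≤ P.card ^ 2 := by
            rw [Finset.offDiag_card, sq]; exact Nat.sub_le _ _
          exact_mod_cast this
  calc ∑ d ∈ I.filter Squarefree, (hneg g d : ℝ)
      ≤ ∑ d ∈ I.filter Squarefree, H * ((if 4 * (S d).card < P.card then 1 else 0) +
          (4 / P.card + 16 / P.card ^ 2 * R d)) := Finset.sum_le_sum hpoint
    _ ≤ ∑ d ∈ I, H * ((if 4 * (S d).card < P.card then 1 else 0) +
          (4 / P.card + 16 / P.card ^ 2 * R d)) :=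
        Finset.sum_le_sum_of_subset_of_nonneg (Finset.filter_subset _ _)
          fun _ _ _ => by positivity
    _ = H * (∑ d ∈ I, (if 4 * (S d).card < P.card then 1 else 0 : ℝ) +
          (Y * (4 / P.card) + 16 / P.card ^ 2 * ∑ d ∈ I, (R d : ℝ))) := by
        rw [← Finset.mul_sum, Finset.sum_add_distrib, Finset.sum_add_distrib, ← Finset.mul_sum,
          Finset.sum_const, nsmul_eq_mul]
        simp only [I, Nat.card_Ico]
        rw [show 2 * Y - Y = Y by omega]
    _ ≤ H * (8 * Y / P.card + 4 * n ^ 2 + (Y * (4 / P.card) + 16 / P.card ^ 2 *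
          (P.card ^ 2 * (T * (T * (32 * √Y + 2 * n ^ g / √Y)))))) := by gcongr
    _ = _ := by
        congr 1
        field_simp
        ring

theorem exists_sum_hneg_dyadic_le {g : ℕ} (hg : Odd g) (hg5 : 5 ≤ g) {ε : ℝ} (hε : 0 < ε) :
    ∃ C : ℝ, 0 < C ∧ ∀ Y : ℕ, 0 < Y →
      ∑ d ∈ (Finset.Ico Y (2 * Y)).filter Squarefree, (hneg g d : ℝ) ≤
        C * (Y : ℝ) ^ ((3 : ℝ) / 2 - 3 / (2 * g + 2) + ε) := by
  set δ : ℝ := min (ε / 10) 1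
  have hδ : 0 < δ := by positivity
  have hδ1 : δ ≤ 1 := min_le_right _ _
  have hδε : 10 * δ ≤ ε := by have : δ ≤ ε / 10 := min_le_left _ _; linarith
  obtain ⟨C₀, hC₀, hdiv⟩ := exists_card_divisors_le_mul_rpow hδ
  obtain ⟨c, hc, hprimes⟩ := exists_mul_rpow_le_card_odd_primes hδ
  have hg' : (5 : ℝ) ≤ g := by exact_mod_cast hg5
  set α : ℝ := 3 / (2 * g + 2)
  have hα0 : 0 < α := by positivity
  have hα4 : α ≤ 1 / 4 := by
    simp only [α]; rw [div_le_div_iff₀ (by positivity) (by norm_num)]; linarith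
  have hαg : α * g = 3 / 2 - α := by simp only [α]; field_simp; ring
  set A : ℝ := 16 + 4 * 4 ^ (2 * g)
  have hA : 0 < A := by positivity
  set C₁ : ℝ := C₀ * A ^ δ
  have hC₁ : 0 < C₁ := by positivity
  refine ⟨5 * C₁ * (12 / c + 64 + 16 * C₁ ^ 2 * (32 + 2 * 4 ^ g)), by positivity, fun Y hY => ?_⟩
  have hy : (1 : ℝ) ≤ Y := by exact_mod_cast hY
  set y : ℝ := (Y : ℝ)
  have hy0 : 0 < y := by linarith
  set E : ℝ := y ^ δ
  have hE : 1 ≤ E := Real.one_le_rpow hy hδ.le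
  set W : ℝ := y ^ (1 - α)
  have hW : 0 < W := by positivity
  have hyα : 1 ≤ y ^ α := Real.one_le_rpow hy hα0.le
  set n : ℕ := ⌈3 * y ^ α⌉₊
  have hn : 3 * y ^ α ≤ n := Nat.le_ceil _
  have hn4 : (n : ℝ) ≤ 4 * y ^ α := by
    have := Nat.ceil_lt_add_one (a := 3 * y ^ α) (by positivity)
    linarith
  have hn3 : 3 ≤ n := by
    have : (3 : ℝ) ≤ n := by linarith
    exact_mod_cast this
  set P := (Finset.Icc 1 n).filter fun p => p.Prime ∧ p ≠ 2
  have hP : ∀ p ∈ P, p.Prime ∧ p ≠ 2 ∧ p ≤ n := by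
    intro p hp
    obtain ⟨h1, h2, h3⟩ := Finset.mem_filter.mp hp
    exact ⟨h2, h3, (Finset.mem_Icc.mp h1).2⟩
  have hPne : P.Nonempty :=
    ⟨3, Finset.mem_filter.mpr ⟨Finset.mem_Icc.mpr ⟨by norm_num, hn3⟩, Nat.prime_three, by norm_num⟩⟩
  have hπ : (0 : ℝ) < P.card := by exact_mod_cast hPne.card_pos
  have hT : ∀ m : ℕ, 0 < m → m ≤ 16 * Y + 4 * n ^ (2 * g) → (m.divisors.card : ℝ) ≤ C₁ * E ^ 3 := by
    intro m hm hmle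
    have h1 : (m : ℝ) ≤ 16 * y + 4 * (n : ℝ) ^ (2 * g) := by
      simp only [y]; exact_mod_cast hmle
    have h2 : (n : ℝ) ^ (2 * g) ≤ 4 ^ (2 * g) * y ^ (3 : ℝ) := by
      calc (n : ℝ) ^ (2 * g) ≤ (4 * y ^ α) ^ (2 * g) := by gcongr
        _ = 4 ^ (2 * g) * y ^ (α * (2 * g : ℕ)) := by
            rw [mul_pow, Real.rpow_mul hy0.le, Real.rpow_natCast]
        _ ≤ _ := by
            have : α * (2 * g : ℕ) ≤ 3 := by push_cast; linarith
            gcongr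
    have h3 : y ≤ y ^ (3 : ℝ) := Real.self_le_rpow_of_one_le hy (by norm_num)
    have h4 : (m : ℝ) ≤ A * y ^ (3 : ℝ) := by simp only [A]; linarith
    calc (m.divisors.card : ℝ) ≤ C₀ * (m : ℝ) ^ δ := hdiv m hm
      _ ≤ C₀ * (A * y ^ (3 : ℝ)) ^ δ := by gcongr
      _ = C₁ * E ^ 3 := by
          rw [Real.mul_rpow hA.le (by positivity), ← Real.rpow_mul hy0.le, mul_comm (3 : ℝ),
            Real.rpow_mul hy0.le, Real.rpow_ofNat, mul_assoc]
  have hπ2 : 12 * y / P.card ≤ 12 / c * (W * E) := by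
    have h1 : c * (y ^ α / E) ≤ P.card := by
      refine le_trans ?_ (hprimes n hn3)
      gcongr
      calc y ^ α / E = y ^ (α - δ) := by rw [Real.rpow_sub hy0]
        _ ≤ y ^ (α * (1 - δ)) := Real.rpow_le_rpow_of_exponent_le hy (by nlinarith)
        _ = (y ^ α) ^ (1 - δ) := Real.rpow_mul hy0.le _ _
        _ ≤ (n : ℝ) ^ (1 - δ) := by gcongr; linarith
    have h2 : W = y / y ^ α := by simp only [W]; rw [Real.rpow_sub hy0, Real.rpow_one]
    calc 12 * y / P.card ≤ 12 * y / (c * (y ^ α / E)) := by gcongr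
      _ = _ := by rw [h2]; field_simp
  have hn2 : 4 * (n : ℝ) ^ 2 ≤ 64 * W := by
    calc 4 * (n : ℝ) ^ 2 ≤ 4 * (4 * y ^ α) ^ 2 := by gcongr
      _ = 64 * y ^ (α * (2 : ℕ)) := by
          rw [Real.rpow_mul hy0.le, Real.rpow_natCast]; ring
      _ ≤ 64 * W := by
          have : α * (2 : ℕ) ≤ 1 - α := by push_cast; linarith
          have := Real.rpow_le_rpow_of_exponent_le hy this
          gcongr
  have hsq : √y ≤ W := by
    rw [Real.sqrt_eq_rpow]
    exact Real.rpow_le_rpow_of_exponent_le hy (by linarith)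
  have hng : (n : ℝ) ^ g / √y ≤ 4 ^ g * W := by
    rw [div_le_iff₀ (by positivity)]
    calc (n : ℝ) ^ g ≤ (4 * y ^ α) ^ g := by gcongr
      _ = 4 ^ g * y ^ (α * g) := by rw [mul_pow, Real.rpow_mul hy0.le, Real.rpow_natCast]
      _ = 4 ^ g * W * √y := by
          rw [hαg, Real.sqrt_eq_rpow, mul_assoc, ← Real.rpow_add hy0]
          congr 2; ring
  have hH : 2 * √(2 * y) + 1 ≤ 5 * √y := by
    have h1 : (1 : ℝ) ≤ √y := Real.one_le_sqrt.mpr hy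
    have h2 : √(2 * y) ≤ 2 * √y := by
      rw [Real.sqrt_le_left (by positivity), mul_pow, Real.sq_sqrt hy0.le]; linarith
    linarith
  refine (sum_hneg_dyadic_le hg hY hP hPne hT).trans ?_
  have hWE : W ≤ W * E := le_mul_of_one_le_right hW.le hE
  have hE7 : E ≤ E ^ 7 := le_self_pow₀ hE (by norm_num)
  have hE6 : E ^ 6 ≤ E ^ 7 := pow_le_pow_right₀ hE (by norm_num)
  have hE17 : 1 ≤ E ^ 7 := one_le_pow₀ hE
  calc (2 * √(2 * y) + 1) * (C₁ * E ^ 3) * (12 * y / P.card + 4 * (n : ℝ) ^ 2 +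
        16 * (C₁ * E ^ 3 * (C₁ * E ^ 3 * (32 * √y + 2 * (n : ℝ) ^ g / √y))))
      ≤ 5 * √y * (C₁ * E ^ 3) * (12 / c * (W * E) + 64 * W +
        16 * (C₁ * E ^ 3 * (C₁ * E ^ 3 * (32 * W + 2 * (4 ^ g * W))))) := by
        rw [mul_div_assoc 2]
        gcongr
    _ = 5 * √y * (C₁ * E ^ 3) * (12 / c * (W * E) + 64 * (W * 1) +
        16 * C₁ ^ 2 * (32 + 2 * 4 ^ g) * (W * E ^ 6)) := by ring
    _ ≤ 5 * √y * (C₁ * E ^ 3) * (12 / c * (W * E ^ 7) + 64 * (W * E ^ 7) +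
        16 * C₁ ^ 2 * (32 + 2 * 4 ^ g) * (W * E ^ 7)) := by gcongr
    _ = 5 * C₁ * (12 / c + 64 + 16 * C₁ ^ 2 * (32 + 2 * 4 ^ g)) * (√y * W * E ^ 10) := by ring
    _ ≤ _ := by
        gcongr
        rw [Real.sqrt_eq_rpow, ← Real.rpow_natCast E, ← Real.rpow_mul hy0.le, ← Real.rpow_add hy0,
          ← Real.rpow_add hy0]
        refine Real.rpow_le_rpow_of_exponent_le hy ?_
        push_cast
        linarith

/-- Passing from dyadic blocks to an initial segment. -/
lemma exists_sum_le_of_sum_dyadic_le {f : ℕ → ℝ} (hf : ∀ d, 0 ≤ f d) {p : ℕ → Prop}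
    [DecidablePred p] {C s : ℝ} (hC : 0 < C) (hs : 0 < s)
    (h : ∀ Y : ℕ, 0 < Y → ∑ d ∈ (Finset.Ico Y (2 * Y)).filter p, f d ≤ C * (Y : ℝ) ^ s) :
    ∃ C' : ℝ, 0 < C' ∧ ∀ N : ℕ, 0 < N →
      ∑ d ∈ (Finset.Icc 1 N).filter p, f d ≤ C' * (N : ℝ) ^ s := by
  set r : ℝ := 2 ^ s
  have hr : 1 < r := Real.one_lt_rpow one_lt_two hs
  have hr1 : 0 < r - 1 := sub_pos.mpr hr
  refine ⟨C * (r / (r - 1)), by positivity, fun N hN => ?_⟩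
  have hmaps : ∀ d ∈ (Finset.Icc 1 N).filter p, Nat.log 2 d ∈ Finset.range (Nat.log 2 N + 1) := by
    intro d hd
    have := Finset.mem_Icc.mp (Finset.mem_filter.mp hd).1
    exact Finset.mem_range.mpr (Nat.lt_succ_iff.mpr (Nat.log_mono_right this.2))
  have hpow : ∀ k : ℕ, ((2 ^ k : ℕ) : ℝ) ^ s = r ^ k := by
    intro k
    push_cast
    rw [← Real.rpow_natCast, ← Real.rpow_natCast, ← Real.rpow_mul zero_le_two,
      ← Real.rpow_mul zero_le_two, mul_comm]
  calc ∑ d ∈ (Finset.Icc 1 N).filter p, f d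
      = ∑ k ∈ Finset.range (Nat.log 2 N + 1),
          ∑ d ∈ ((Finset.Icc 1 N).filter p).filter fun d => Nat.log 2 d = k, f d :=
        (Finset.sum_fiberwise_of_maps_to hmaps f).symm
    _ ≤ ∑ k ∈ Finset.range (Nat.log 2 N + 1), C * r ^ k := by
        refine Finset.sum_le_sum fun k _ => ?_
        rw [← hpow]
        refine le_trans ?_ (h (2 ^ k) (by positivity))
        refine Finset.sum_le_sum_of_subset_of_nonneg ?_ fun d _ _ => hf d
        intro d hd
        obtain ⟨hdp, rfl⟩ := Finset.mem_filter.mp hd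
        obtain ⟨hdN, hpd⟩ := Finset.mem_filter.mp hdp
        have hd0 : d ≠ 0 := by have := (Finset.mem_Icc.mp hdN).1; omega
        refine Finset.mem_filter.mpr ⟨Finset.mem_Ico.mpr ⟨Nat.pow_log_le_self 2 hd0, ?_⟩, hpd⟩
        rw [← pow_succ']
        exact Nat.lt_pow_succ_log_self one_lt_two d
    _ = C * ((r ^ (Nat.log 2 N + 1) - 1) / (r - 1)) := by
        rw [← Finset.mul_sum, geom_sum_eq hr.ne']
    _ ≤ C * (r ^ (Nat.log 2 N + 1) / (r - 1)) := by gcongr; linarith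
    _ = C * (r / (r - 1)) * r ^ Nat.log 2 N := by rw [pow_succ]; ring
    _ ≤ _ := by
        rw [← hpow]
        gcongr
        exact Nat.pow_log_le_self 2 hN.ne'

/-- For each prime `g ≥ 5` and every `ε > 0` there is `C = C(g, ε)` such that for
all `X ≥ 2`, `∑_{0 < d < X, d squarefree} h_g(-d) ≤ C · X^(3/2 - 3/(2g+2) + ε)`. -/
theorem average_hg_bound (g : ℕ) (hg : g.Prime) (hg5 : 5 ≤ g) (ε : ℝ) (hε : 0 < ε) :
    ∃ C : ℝ, 0 < C ∧ ∀ X : ℝ, 2 ≤ X →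
      ∑ d ∈ (Finset.range (⌈X⌉₊ + 1)).filter
          (fun d : ℕ => Squarefree d ∧ 0 < d ∧ (d : ℝ) < X),
        (hneg g d : ℝ)
      ≤ C * X ^ ((3 : ℝ) / 2 - 3 / (2 * g + 2) + ε) := by
  have hs : 0 < (3 : ℝ) / 2 - 3 / (2 * g + 2) + ε := by
    have h1 : (5 : ℝ) ≤ g := by exact_mod_cast hg5
    have h2 : (3 : ℝ) / (2 * g + 2) ≤ 1 := by
      rw [div_le_one (by positivity)]; linarith
    linarith
  obtain ⟨C₀, hC₀, hblock⟩ :=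
    exists_sum_hneg_dyadic_le (hg.odd_of_ne_two (by omega)) hg5 hε
  obtain ⟨C, hC, hbound⟩ :=
    exists_sum_le_of_sum_dyadic_le (fun d => Nat.cast_nonneg (hneg g d)) hC₀ hs hblock
  refine ⟨C, hC, fun X hX => ?_⟩
  have hX0 : 0 ≤ X := by linarith
  calc ∑ d ∈ (Finset.range (⌈X⌉₊ + 1)).filter
          (fun d : ℕ => Squarefree d ∧ 0 < d ∧ (d : ℝ) < X), (hneg g d : ℝ)
      ≤ ∑ d ∈ (Finset.Icc 1 ⌊X⌋₊).filter Squarefree, (hneg g d : ℝ) := by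
        refine Finset.sum_le_sum_of_subset_of_nonneg (fun d hd => ?_)
          fun _ _ _ => Nat.cast_nonneg _
        obtain ⟨-, hsq, hd0, hdX⟩ := Finset.mem_filter.mp hd
        exact Finset.mem_filter.mpr
          ⟨Finset.mem_Icc.mpr ⟨hd0, Nat.le_floor hdX.le⟩, hsq⟩
    _ ≤ C * (⌊X⌋₊ : ℝ) ^ _ := hbound _ (Nat.floor_pos.mpr (by linarith))
    _ ≤ _ := by
        gcongr
        exact Nat.floor_le hX0
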